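/- arXiv:2602.09300 — 10 statements merged into one kernel-verified Lean document; each statement's English description precedes it below -/
import Mathlib

section
/- Let ν ∈ (0,1) and define e_ν(x) = x²·|ν − 1{x ≤ 0}|. Let X be a real random variable with E[X²] < ∞ such that P(X = k) = 0 for every k ∈ ℝ. Then the function 𝓛_ν(k) := E[e_ν(X − k)] is differentiable on ℝ with 𝓛_ν'(k) = E[2ν(k − X)·1{X > k} + 2(1 − ν)(k − X)·1{X ≤ k}], and 𝓛_ν' is Lipschitz continuous with constant L_ν = 2·max(ν, 1 − ν); i.e., 𝓛_ν is L_ν-smooth. -/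
open MeasureTheory

open Filter Topology in
/-- A function with a quadratically small first-order Taylor remainder is differentiable. -/
theorem hasDerivAt_of_abs_sub_sub_le_sq {f : ℝ → ℝ} {f' k C : ℝ}
    (h : ∀ k', |f k' - f k - (k' - k) * f'| ≤ C * (k' - k) ^ 2) : HasDerivAt f f' k := by
  rw [hasDerivAt_iff_isLittleO]
  refine Asymptotics.IsBigO.trans_isLittleO (g := fun k' => ‖k' - k‖ ^ 2) ?_
    (Asymptotics.isLittleO_pow_sub_sub k one_lt_two)
  refine Asymptotics.IsBigO.of_bound C (Eventually.of_forall fun k' => ?_)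
  simpa [smul_eq_mul] using h k'

/-- The expectile loss `e_ν(x - k)`. -/
noncomputable def expectileLoss (ν x k : ℝ) : ℝ :=
  (x - k) ^ 2 * |ν - (if x - k ≤ 0 then (1 : ℝ) else 0)|

/-- The derivative in `k` of the expectile loss `e_ν(x - k)`. -/
noncomputable def expectileGrad (ν x k : ℝ) : ℝ :=
  2 * ν * (k - x) * (if k < x then (1 : ℝ) else 0)
    + 2 * (1 - ν) * (k - x) * (if x ≤ k then (1 : ℝ) else 0)

section Pointwise

variable {ν : ℝ}

theorem expectileLoss_of_lt (hν : ν ∈ Set.Ioo (0 : ℝ) 1) {x k : ℝ} (h : k < x) :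
    expectileLoss ν x k = ν * (x - k) ^ 2 := by
  have : ¬ x ≤ k := h.not_ge
  simp [expectileLoss, this, abs_of_pos hν.1, mul_comm]

theorem expectileLoss_of_le (hν : ν ∈ Set.Ioo (0 : ℝ) 1) {x k : ℝ} (h : x ≤ k) :
    expectileLoss ν x k = (1 - ν) * (x - k) ^ 2 := by
  have : |ν - 1| = 1 - ν := by rw [abs_of_neg (by linarith [hν.2])]; ring
  simp [expectileLoss, h, this, mul_comm]

theorem expectileGrad_of_lt {x k : ℝ} (h : k < x) :
    expectileGrad ν x k = 2 * ν * (k - x) := by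
  simp [expectileGrad, h, h.not_ge]

theorem expectileGrad_of_le {x k : ℝ} (h : x ≤ k) :
    expectileGrad ν x k = 2 * (1 - ν) * (k - x) := by
  simp [expectileGrad, h, h.not_gt]

theorem abs_expectileLoss_sub_sub_le (hν : ν ∈ Set.Ioo (0 : ℝ) 1) (x k k' : ℝ) :
    |expectileLoss ν x k' - expectileLoss ν x k - (k' - k) * expectileGrad ν x k|
      ≤ (k' - k) ^ 2 := by
  obtain ⟨h0, h1⟩ := hν
  have h2 : 0 < 1 - ν := by linarith
  have hν : ν ∈ Set.Ioo (0 : ℝ) 1 := ⟨h0, h1⟩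
  rcases lt_or_ge k x with h | h <;> rcases lt_or_ge k' x with h' | h'
  · rw [expectileLoss_of_lt hν h, expectileLoss_of_lt hν h', expectileGrad_of_lt h, abs_le]
    constructor <;> nlinarith [mul_nonneg h0.le (sq_nonneg (k' - k)),
      mul_nonneg h2.le (sq_nonneg (k' - k))]
  · rw [expectileLoss_of_lt hν h, expectileLoss_of_le hν h', expectileGrad_of_lt h]
    have e : (1 - ν) * (x - k') ^ 2 - ν * (x - k) ^ 2 - (k' - k) * (2 * ν * (k - x))
        = ν * ((k' - k) ^ 2 - (k' - x) ^ 2) + (1 - ν) * (k' - x) ^ 2 := by ring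
    have b : (k' - x) ^ 2 ≤ (k' - k) ^ 2 := by nlinarith
    rw [e, abs_of_nonneg (add_nonneg (mul_nonneg h0.le (sub_nonneg.2 b)) (by positivity))]
    nlinarith [mul_nonneg h0.le (sq_nonneg (k' - x)), mul_le_mul_of_nonneg_left b h2.le]
  · rw [expectileLoss_of_le hν h, expectileLoss_of_lt hν h', expectileGrad_of_le h]
    have e : ν * (x - k') ^ 2 - (1 - ν) * (x - k) ^ 2 - (k' - k) * (2 * (1 - ν) * (k - x))
        = (1 - ν) * ((k' - k) ^ 2 - (k' - x) ^ 2) + ν * (k' - x) ^ 2 := by ring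
    have b : (k' - x) ^ 2 ≤ (k' - k) ^ 2 := by nlinarith
    rw [e, abs_of_nonneg (add_nonneg (mul_nonneg h2.le (sub_nonneg.2 b)) (by positivity))]
    nlinarith [mul_nonneg h2.le (sq_nonneg (k' - x)), mul_le_mul_of_nonneg_left b h0.le]
  · rw [expectileLoss_of_le hν h, expectileLoss_of_le hν h', expectileGrad_of_le h, abs_le]
    constructor <;> nlinarith [mul_nonneg h0.le (sq_nonneg (k' - k)),
      mul_nonneg h2.le (sq_nonneg (k' - k))]

theorem abs_expectileGrad_sub_le (hν : ν ∈ Set.Ioo (0 : ℝ) 1) (x k₁ k₂ : ℝ) :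
    |expectileGrad ν x k₁ - expectileGrad ν x k₂| ≤ 2 * max ν (1 - ν) * |k₁ - k₂| := by
  wlog hk : k₂ ≤ k₁ generalizing k₁ k₂
  · rw [abs_sub_comm, abs_sub_comm k₁]
    exact this k₂ k₁ (le_of_not_ge hk)
  obtain ⟨h0, h1⟩ := hν
  have h2 : 0 < 1 - ν := by linarith
  have m1 := le_max_left ν (1 - ν)
  have m2 := le_max_right ν (1 - ν)
  rw [abs_of_nonneg (sub_nonneg.2 hk), abs_le]
  rcases lt_or_ge k₁ x with h | h <;> rcases lt_or_ge k₂ x with h' | h'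
  · rw [expectileGrad_of_lt h, expectileGrad_of_lt h']
    constructor <;> nlinarith
  · exact absurd (h'.trans hk) h.not_ge
  · rw [expectileGrad_of_le h, expectileGrad_of_lt h']
    constructor <;> nlinarith
  · rw [expectileGrad_of_le h, expectileGrad_of_le h']
    constructor <;> nlinarith

end Pointwise

section Integrability

variable {Ω : Type*} [MeasurableSpace Ω] {μ : Measure Ω} [IsFiniteMeasure μ] {ν : ℝ} {X : Ω → ℝ}

theorem integrable_expectileGrad (hν : ν ∈ Set.Ioo (0 : ℝ) 1) (hXm : Measurable X)
    (hX : Integrable X μ) (k : ℝ) : Integrable (fun ω => expectileGrad ν (X ω) k) μ := by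
  refine ((hX.sub (integrable_const k)).const_mul 2).mono ?_ (ae_of_all _ fun ω => ?_)
  · unfold expectileGrad
    refine Measurable.aestronglyMeasurable ?_
    have a := measurableSet_lt (measurable_const (a := k)) hXm
    have b := measurableSet_le hXm (measurable_const (a := k))
    exact (by fun_prop : Measurable fun ω => 2 * ν * (k - X ω)).mul
      (Measurable.ite a measurable_const measurable_const) |>.add <|
      (by fun_prop : Measurable fun ω => 2 * (1 - ν) * (k - X ω)).mul
      (Measurable.ite b measurable_const measurable_const)
  · obtain ⟨h0, h1⟩ := hν
    have h2 : 0 < 1 - ν := by linarith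
    rcases lt_or_ge k (X ω) with h | h
    · rw [expectileGrad_of_lt h]
      simp only [Pi.sub_apply, norm_mul, Real.norm_eq_abs, abs_of_pos h0, abs_sub_comm k]
      rw [abs_of_pos (two_pos (α := ℝ))]
      nlinarith [abs_nonneg (X ω - k)]
    · rw [expectileGrad_of_le h]
      simp only [Pi.sub_apply, norm_mul, Real.norm_eq_abs, abs_of_pos h2, abs_sub_comm k]
      rw [abs_of_pos (two_pos (α := ℝ))]
      nlinarith [abs_nonneg (X ω - k)]

theorem integrable_expectileLoss (hν : ν ∈ Set.Ioo (0 : ℝ) 1) (hXm : Measurable X)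
    (hX : MemLp X 2 μ) (k : ℝ) : Integrable (fun ω => expectileLoss ν (X ω) k) μ := by
  refine (hX.sub (memLp_const k)).integrable_sq.mono ?_ (ae_of_all _ fun ω => ?_)
  · unfold expectileLoss
    refine Measurable.aestronglyMeasurable ?_
    have b := measurableSet_le (hXm.sub_const k) (measurable_const (a := (0 : ℝ)))
    exact ((hXm.sub_const k).pow_const 2).mul
      (measurable_const.sub (Measurable.ite b measurable_const measurable_const)).abs
  · obtain ⟨h0, h1⟩ := id hν
    have hnn : 0 ≤ expectileLoss ν (X ω) k := mul_nonneg (sq_nonneg _) (abs_nonneg _)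
    rw [Real.norm_of_nonneg hnn, Real.norm_of_nonneg (sq_nonneg _), Pi.sub_apply]
    rcases lt_or_ge k (X ω) with h | h
    · rw [expectileLoss_of_lt hν h]
      nlinarith [sq_nonneg (X ω - k)]
    · rw [expectileLoss_of_le hν h]
      nlinarith [sq_nonneg (X ω - k)]

end Integrability

/-- For ν ∈ (0,1), with `e_ν(x) = x² * |ν − 1{x ≤ 0}|`, and a real random
variable `X` with `E[X²] < ∞` and `P(X = k) = 0` for all `k`, the function
`𝓛_ν(k) = E[e_ν(X − k)]` is differentiable with derivative
`E[2ν(k − X)1{X > k} + 2(1 − ν)(k − X)1{X ≤ k}]`, and this derivative is Lipschitz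
with constant `L_ν = 2·max(ν, 1 − ν)`. -/
theorem expectile_loss_smooth
    {Ω : Type*} [MeasurableSpace Ω] (μ : Measure Ω) [IsProbabilityMeasure μ]
    (ν : ℝ) (hν : ν ∈ Set.Ioo (0 : ℝ) 1)
    (X : Ω → ℝ) (hXmeas : Measurable X)
    (hX2 : Integrable (fun ω => (X ω) ^ 2) μ)
    (hXcont : ∀ k : ℝ, μ {ω | X ω = k} = 0) :
    (∀ k : ℝ,
      HasDerivAt
        (fun k' : ℝ =>
          ∫ ω, (X ω - k') ^ 2 * |ν - (if X ω - k' ≤ 0 then (1 : ℝ) else 0)| ∂μ)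
        (∫ ω, (2 * ν * (k - X ω) * (if k < X ω then (1 : ℝ) else 0)
              + 2 * (1 - ν) * (k - X ω) * (if X ω ≤ k then (1 : ℝ) else 0)) ∂μ) k)
    ∧ (∀ k₁ k₂ : ℝ,
        |(∫ ω, (2 * ν * (k₁ - X ω) * (if k₁ < X ω then (1 : ℝ) else 0)
              + 2 * (1 - ν) * (k₁ - X ω) * (if X ω ≤ k₁ then (1 : ℝ) else 0)) ∂μ)
          - (∫ ω, (2 * ν * (k₂ - X ω) * (if k₂ < X ω then (1 : ℝ) else 0)
              + 2 * (1 - ν) * (k₂ - X ω) * (if X ω ≤ k₂ then (1 : ℝ) else 0)) ∂μ)|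
          ≤ (2 * max ν (1 - ν)) * |k₁ - k₂|) := by
  have hX : MemLp X 2 μ := (memLp_two_iff_integrable_sq hXmeas.aestronglyMeasurable).2 hX2
  have hL := integrable_expectileLoss hν hXmeas hX
  have hG := integrable_expectileGrad hν hXmeas (hX.integrable one_le_two)
  refine ⟨fun k => ?_, fun k₁ k₂ => ?_⟩
  · change HasDerivAt (fun k' => ∫ ω, expectileLoss ν (X ω) k' ∂μ)
      (∫ ω, expectileGrad ν (X ω) k ∂μ) k
    refine hasDerivAt_of_abs_sub_sub_le_sq (C := 1) fun k' => ?_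
    rw [← integral_const_mul, ← integral_sub (hL k') (hL k),
      ← integral_sub (f := fun ω => expectileLoss ν (X ω) k' - expectileLoss ν (X ω) k)
        ((hL k').sub (hL k)) ((hG k).const_mul _), one_mul]
    simpa using norm_integral_le_of_norm_le_const (μ := μ)
      (f := fun ω => expectileLoss ν (X ω) k' - expectileLoss ν (X ω) k
        - (k' - k) * expectileGrad ν (X ω) k)
      (ae_of_all _ fun ω => abs_expectileLoss_sub_sub_le hν (X ω) k k')
  · change |(∫ ω, expectileGrad ν (X ω) k₁ ∂μ) - ∫ ω, expectileGrad ν (X ω) k₂ ∂μ| ≤ _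
    rw [← integral_sub (hG k₁) (hG k₂)]
    simpa using norm_integral_le_of_norm_le_const (μ := μ)
      (f := fun ω => expectileGrad ν (X ω) k₁ - expectileGrad ν (X ω) k₂)
      (ae_of_all _ fun ω => abs_expectileGrad_sub_le hν (X ω) k₁ k₂)
end

section
/- Let ν ∈ (0,1), let x_1, …, x_m ∈ ℝ, and let ξ̂ ∈ ℝ satisfy (1/m)·Σ_{i=1}^m l_ν(x_i − ξ̂) = 0. Then for every ξ ∈ ℝ, |ξ̂ − ξ| ≤ (2/(m·μ_ν))·|Σ_{i=1}^m l_ν(x_i − ξ)|, where μ_ν = 2·min(ν, 1 − ν). -/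
/-- The asymmetric loss `l_ν(x) = ν·x·1{x > 0} + (1 − ν)·x·1{x ≤ 0}`. -/
noncomputable def lnu (ν x : ℝ) : ℝ := if 0 < x then ν * x else (1 - ν) * x

/-- The asymmetric loss grows at least at rate `min ν (1 - ν)`. -/
theorem min_mul_sub_le_lnu_sub (ν : ℝ) {a b : ℝ} (hab : a ≤ b) :
    min ν (1 - ν) * (b - a) ≤ lnu ν b - lnu ν a := by
  have h₁ := min_le_left ν (1 - ν)
  have h₂ := min_le_right ν (1 - ν)
  generalize min ν (1 - ν) = c at *
  unfold lnu
  split_ifs with hb ha ha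
  · nlinarith [mul_nonneg (sub_nonneg.2 h₁) (sub_nonneg.2 hab)]
  · nlinarith [mul_nonneg (sub_nonneg.2 h₁) hb.le,
      mul_nonneg (sub_nonneg.2 h₂) (neg_nonneg.2 (not_lt.1 ha))]
  · linarith
  · nlinarith [mul_nonneg (sub_nonneg.2 h₂) (sub_nonneg.2 hab)]

/-- The summed identification function decreases at least at rate `m * min ν (1 - ν)`. -/
theorem card_mul_min_mul_sub_le_sum_lnu_sub (ν : ℝ) {m : ℕ} (x : Fin m → ℝ) {s t : ℝ}
    (hst : s ≤ t) :
    m * min ν (1 - ν) * (t - s) ≤ ∑ i, lnu ν (x i - s) - ∑ i, lnu ν (x i - t) := by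
  rw [← Finset.sum_sub_distrib]
  calc m * min ν (1 - ν) * (t - s) = ∑ _i : Fin m, min ν (1 - ν) * (t - s) := by
        simp [mul_assoc]
    _ ≤ _ := Finset.sum_le_sum fun i _ => by
        simpa using min_mul_sub_le_lnu_sub ν (sub_le_sub_left hst (x i))

/-- If `ξ̂` is a root of the empirical expectile identification equation
for samples `x_1, …, x_m`, then for every `ξ`,
`|ξ̂ − ξ| ≤ (2/(m·μ_ν))·|Σ_i l_ν(x_i − ξ)|` with `μ_ν = 2·min(ν, 1 − ν)`. -/
theorem empirical_expectile_deviation_bound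
    (ν : ℝ) (hν : ν ∈ Set.Ioo (0 : ℝ) 1)
    (m : ℕ) (hm : 0 < m) (x : Fin m → ℝ) (ξhat : ℝ)
    (hroot : (1 / (m : ℝ)) * ∑ i, lnu ν (x i - ξhat) = 0) :
    ∀ ξ : ℝ, |ξhat - ξ| ≤ (2 / ((m : ℝ) * (2 * min ν (1 - ν)))) * |∑ i, lnu ν (x i - ξ)| := by
  intro ξ
  have hm' : (0 : ℝ) < m := Nat.cast_pos.2 hm
  have hc : 0 < min ν (1 - ν) := lt_min hν.1 (sub_pos.2 hν.2)
  have hsum : ∑ i, lnu ν (x i - ξhat) = 0 :=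
    (mul_eq_zero.1 hroot).resolve_left (one_div_pos.2 hm').ne'
  have key : m * min ν (1 - ν) * |ξhat - ξ| ≤ |∑ i, lnu ν (x i - ξ)| := by
    rcases le_total ξ ξhat with h | h
    · have := card_mul_min_mul_sub_le_sum_lnu_sub ν x h
      rw [abs_of_nonneg (sub_nonneg.2 h)]
      linarith [le_abs_self (∑ i, lnu ν (x i - ξ))]
    · have := card_mul_min_mul_sub_le_sum_lnu_sub ν x h
      rw [abs_sub_comm, abs_of_nonneg (sub_nonneg.2 h)]
      linarith [neg_le_abs (∑ i, lnu ν (x i - ξ))]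
  have hconst : 2 / ((m : ℝ) * (2 * min ν (1 - ν))) = (m * min ν (1 - ν))⁻¹ := by
    field_simp
  rwa [hconst, le_inv_mul_iff₀ (mul_pos hm' hc)]
end

section
/- Fix ν ∈ (0,1) and n ≥ 1. (a) For every ε > 0 with √n·ε ≤ 1/2 and every measurable estimator ξ̂ : ℝⁿ → ℝ, max over s ∈ {−1, +1} of P_{X ∼ N(sε,1)^{⊗n}}( |ξ̂(X) − (sε + κ_ν)| ≥ ε ) ≥ (1/2)·(1 − √n·ε) ≥ (1/2)·exp(−2√n·ε), where X is a vector of n i.i.d. N(sε,1) samples. (b) Consequently, for every δ ∈ [1/(2e), 1/2) and every measurable estimator ξ̂ : ℝⁿ → ℝ, setting ε = ln(1/(2δ))/(2√n), max over s ∈ {−1, +1} of P_{X ∼ N(sε,1)^{⊗n}}( |ξ̂(X) − (sε + κ_ν)| ≥ ε ) ≥ δ. -/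
open MeasureTheory ProbabilityTheory

theorem gaussianReal_eq_withDensity_gaussianReal_zero (θ : ℝ) :
    gaussianReal θ 1
      = (gaussianReal 0 1).withDensity fun x => ENNReal.ofReal (Real.exp (θ * x - θ ^ 2 / 2)) := by
  rw [gaussianReal_of_var_ne_zero _ one_ne_zero, gaussianReal_of_var_ne_zero _ one_ne_zero,
    ← withDensity_mul _ (measurable_gaussianPDF 0 1) (by fun_prop)]
  congr 1
  ext x
  simp only [Pi.mul_apply, gaussianPDF, gaussianPDFReal]
  rw [← ENNReal.ofReal_mul (by positivity), mul_assoc (_⁻¹), ← Real.exp_add]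
  congr 3
  simp only [NNReal.coe_one]
  ring

theorem pi_withDensity {ι : Type*} [Fintype ι] {α : ι → Type*} [∀ i, MeasurableSpace (α i)]
    (μ : ∀ i, Measure (α i)) [∀ i, IsProbabilityMeasure (μ i)] (f : ∀ i, α i → ENNReal)
    (hf : ∀ i, Measurable (f i)) [∀ i, SigmaFinite ((μ i).withDensity (f i))] :
    Measure.pi (fun i => (μ i).withDensity (f i))
      = (Measure.pi μ).withDensity fun x => ∏ i, f i (x i) := by
  classical
  refine Measure.pi_eq fun s hs => ?_
  have hind : ∀ x : ∀ i, α i, (Set.univ.pi s).indicator (fun x => ∏ i, f i (x i)) x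
      = ∏ i, (s i).indicator (f i) (x i) := by
    intro x
    by_cases hx : x ∈ Set.univ.pi s
    · rw [Set.indicator_of_mem hx]
      exact Finset.prod_congr rfl fun i _ => (Set.indicator_of_mem (hx i trivial) _).symm
    · rw [Set.indicator_of_notMem hx]
      obtain ⟨i, hi⟩ : ∃ i, x i ∉ s i := by simpa [Set.mem_pi] using hx
      exact (Finset.prod_eq_zero (Finset.mem_univ i) (Set.indicator_of_notMem hi _)).symm
  rw [withDensity_apply _ (MeasurableSet.univ_pi hs),
    ← lintegral_indicator (MeasurableSet.univ_pi hs)]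
  simp_rw [hind]
  have hmeas : ∀ i, Measurable ((s i).indicator (f i)) := fun i => (hf i).indicator (hs i)
  have hindep : iIndepFun (fun i (x : ∀ i, α i) => (s i).indicator (f i) (x i)) (Measure.pi μ) :=
    iIndepFun_pi fun i => (hmeas i).aemeasurable
  rw [lintegral_prod_eq_prod_lintegral_of_indepFun Finset.univ _ hindep
    fun i => (hmeas i).comp (measurable_pi_apply i)]
  refine Finset.prod_congr rfl fun i _ => ?_
  rw [withDensity_apply _ (hs i), ← lintegral_indicator (hs i)]
  exact (measurePreserving_eval μ i).lintegral_comp (hmeas i)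

theorem pi_gaussianReal_eq_withDensity (n : ℕ) (θ : ℝ) :
    (Measure.pi fun _ : Fin n => gaussianReal θ 1)
      = (Measure.pi fun _ : Fin n => gaussianReal 0 1).withDensity
        fun x => ∏ i, ENNReal.ofReal (Real.exp (θ * x i - θ ^ 2 / 2)) := by
  have h := gaussianReal_eq_withDensity_gaussianReal_zero θ
  have : SigmaFinite ((gaussianReal 0 1).withDensity
      fun x => ENNReal.ofReal (Real.exp (θ * x - θ ^ 2 / 2))) := by
    rw [← h]; infer_instance
  rw [h]
  exact pi_withDensity (fun _ : Fin n => gaussianReal 0 1) _ fun _ => by fun_prop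

/-- Cauchy–Schwarz for the affinity of `N(θ,1)^{⊗n}` and `N(-θ,1)^{⊗n}`: the geometric mean of
their densities is a constant multiple of the density of `N(0,1)^{⊗n}`. -/
theorem exp_mul_pi_gaussianReal_zero_le (n : ℕ) (θ : ℝ) {s : Set (Fin n → ℝ)}
    (hs : MeasurableSet s) :
    Real.exp (-(n * θ ^ 2 / 2)) * (Measure.pi fun _ : Fin n => gaussianReal 0 1).real s
      ≤ √((Measure.pi fun _ : Fin n => gaussianReal θ 1).real s)
        * √((Measure.pi fun _ : Fin n => gaussianReal (-θ) 1).real s) := by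
  set μ := Measure.pi fun _ : Fin n => gaussianReal 0 1 with hμ
  let f : ℝ → (Fin n → ℝ) → ENNReal :=
    fun t x => ∏ i, ENNReal.ofReal (Real.exp ((t * x i - t ^ 2 / 2) / 2))
  have hf : ∀ t, Measurable (f t) := fun t => by fun_prop
  have hsq : ∀ t, ∫⁻ x in s, f t x ^ (2 : ℝ) ∂μ
      = (Measure.pi fun _ : Fin n => gaussianReal t 1) s := by
    intro t
    rw [pi_gaussianReal_eq_withDensity, withDensity_apply _ hs]
    refine lintegral_congr fun x => ?_
    simp only [f]
    rw [← ENNReal.prod_rpow_of_nonneg zero_le_two]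
    refine Finset.prod_congr rfl fun i _ => ?_
    rw [ENNReal.ofReal_rpow_of_pos (Real.exp_pos _), ← Real.exp_mul]
    congr 2
    ring
  have hmul : ∀ x, (f θ * f (-θ)) x = ENNReal.ofReal (Real.exp (-(n * θ ^ 2 / 2))) := by
    intro x
    simp only [f, Pi.mul_apply]
    rw [← Finset.prod_mul_distrib]
    have : ∀ i, ENNReal.ofReal (Real.exp ((θ * x i - θ ^ 2 / 2) / 2))
        * ENNReal.ofReal (Real.exp ((-θ * x i - (-θ) ^ 2 / 2) / 2))
        = ENNReal.ofReal (Real.exp (-(θ ^ 2 / 2))) := by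
      intro i
      rw [← ENNReal.ofReal_mul (Real.exp_pos _).le, ← Real.exp_add]
      congr 2
      ring
    simp_rw [this]
    rw [Finset.prod_const, Finset.card_univ, Fintype.card_fin,
      ← ENNReal.ofReal_pow (Real.exp_pos _).le, ← Real.exp_nat_mul]
    congr 2
    ring
  have key := ENNReal.lintegral_mul_le_Lp_mul_Lq (μ.restrict s) Real.HolderConjugate.two_two
    (hf θ).aemeasurable (hf (-θ)).aemeasurable
  simp_rw [hmul] at key
  rw [hsq, hsq, setLIntegral_const] at key
  have := ENNReal.toReal_mono (by finiteness) key
  rw [ENNReal.toReal_mul, ENNReal.toReal_mul, ENNReal.toReal_ofReal (Real.exp_pos _).le,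
    ← ENNReal.toReal_rpow, ← ENNReal.toReal_rpow, ← Real.sqrt_eq_rpow, ← Real.sqrt_eq_rpow] at this
  exact this

/-- Total variation is controlled by the Hellinger affinity, for two-point distributions. -/
theorem sq_sub_le_one_sub_sq_affinity {a b c : ℝ} (ha : 0 ≤ a) (ha1 : a ≤ 1) (hb : 0 ≤ b)
    (hb1 : b ≤ 1) (hc : 0 ≤ c) (h : c ≤ √a * √b + √(1 - a) * √(1 - b)) :
    (a - b) ^ 2 ≤ 1 - c ^ 2 := by
  have h1 := Real.sq_sqrt ha
  have h2 := Real.sq_sqrt hb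
  have h3 := Real.sq_sqrt (sub_nonneg.2 ha1)
  have h4 := Real.sq_sqrt (sub_nonneg.2 hb1)
  set x := √a
  set y := √b
  set z := √(1 - a)
  set w := √(1 - b)
  have hc2 : c ^ 2 ≤ (x * y + z * w) ^ 2 := pow_le_pow_left₀ hc h 2
  have hxz : x ^ 2 + z ^ 2 = 1 := by linarith
  have hyw : y ^ 2 + w ^ 2 = 1 := by linarith
  have e1 : 1 - (x * y + z * w) ^ 2 = (x * w - z * y) ^ 2 := by
    linear_combination -(y ^ 2 + w ^ 2) * hxz - hyw
  have e2 : a - b = (x * w - z * y) * (x * w + z * y) := by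
    linear_combination -h1 + h2 - x ^ 2 * hyw + y ^ 2 * hxz
  have e3 : (x * w + z * y) ^ 2 ≤ 1 := by
    have : 1 - (x * w + z * y) ^ 2 = (x * y - z * w) ^ 2 := by
      linear_combination -(y ^ 2 + w ^ 2) * hxz - hyw
    nlinarith [sq_nonneg (x * y - z * w)]
  rw [e2, mul_pow]
  nlinarith [sq_nonneg (x * w - z * y), mul_le_of_le_one_right (sq_nonneg (x * w - z * y)) e3]

theorem pi_gaussianReal_sub_le (n : ℕ) {θ : ℝ} (hθ : 0 ≤ θ) {s : Set (Fin n → ℝ)}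
    (hs : MeasurableSet s) :
    (Measure.pi fun _ : Fin n => gaussianReal (-θ) 1).real s
      - (Measure.pi fun _ : Fin n => gaussianReal θ 1).real s ≤ √n * θ := by
  have h1 := exp_mul_pi_gaussianReal_zero_le n θ hs
  have h2 := exp_mul_pi_gaussianReal_zero_le n θ hs.compl
  rw [probReal_compl_eq_one_sub hs, probReal_compl_eq_one_sub hs,
    probReal_compl_eq_one_sub hs] at h2
  have h12 := add_le_add h1 h2
  rw [← mul_add, add_sub_cancel, mul_one] at h12
  have h := sq_sub_le_one_sub_sq_affinity measureReal_nonneg measureReal_le_one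
    measureReal_nonneg measureReal_le_one (Real.exp_pos (-(n * θ ^ 2 / 2))).le h12
  rw [← Real.exp_nat_mul] at h
  have hexp := Real.add_one_le_exp (((2 : ℕ) : ℝ) * -(n * θ ^ 2 / 2))
  push_cast at h hexp
  refine (le_abs_self _).trans (abs_le_of_sq_le_sq ?_ (by positivity))
  rw [mul_pow, Real.sq_sqrt (Nat.cast_nonneg n)]
  nlinarith

theorem exp_neg_two_mul_le_one_sub {t : ℝ} (h0 : 0 ≤ t) (h1 : t ≤ 1 / 2) :
    Real.exp (-(2 * t)) ≤ 1 - t := by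
  rw [Real.exp_neg]
  have h := Real.add_one_le_exp (2 * t)
  rw [inv_le_iff_one_le_mul₀ (Real.exp_pos _)]
  nlinarith

theorem le_max_measure_error_pi_gaussianReal (n : ℕ) (κ : ℝ) {ε : ℝ} (hε : 0 ≤ ε)
    {est : (Fin n → ℝ) → ℝ} (hest : Measurable est) :
    ENNReal.ofReal ((1 / 2) * (1 - √n * ε))
      ≤ max
          ((Measure.pi fun _ : Fin n => gaussianReal ε 1) {x | ε ≤ |est x - (ε + κ)|})
          ((Measure.pi fun _ : Fin n => gaussianReal (-ε) 1) {x | ε ≤ |est x - (-ε + κ)|}) := by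
  set P := Measure.pi fun _ : Fin n => gaussianReal ε 1
  set Q := Measure.pi fun _ : Fin n => gaussianReal (-ε) 1
  set A := {x | ε ≤ |est x - (ε + κ)|}
  set B := {x | ε ≤ |est x - (-ε + κ)|}
  have hA : MeasurableSet A := measurableSet_le measurable_const (by fun_prop)
  have hAB : Aᶜ ⊆ B := by
    intro x hx
    simp only [A, B, Set.mem_compl_iff, Set.mem_ofPred_eq, not_le] at hx ⊢
    rw [abs_lt] at hx
    exact le_trans (by linarith [hx.1]) (le_abs_self _)
  have hsub : Q.real A - P.real A ≤ √n * ε := pi_gaussianReal_sub_le n hε hA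
  have hB : 1 - Q.real A ≤ Q.real B := by
    rw [← probReal_compl_eq_one_sub hA]
    exact measureReal_mono hAB
  rcases le_or_gt ((1 / 2) * (1 - √n * ε)) (P.real A) with h | h
  · exact le_max_of_le_left (ENNReal.ofReal_le_of_le_toReal h)
  · exact le_max_of_le_right (ENNReal.ofReal_le_of_le_toReal
      (show _ ≤ Q.real B by linarith))

/-- Le Cam two-point lower bound for expectile estimation from `n` i.i.d.
Gaussian samples.  (a) For every `ε > 0` with `√n·ε ≤ 1/2` and every measurable
estimator, the worst of the two error probabilities under `N(±ε,1)^{⊗n}` is at least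
`(1/2)(1 − √n·ε) ≥ (1/2)·exp(−2√n·ε)`.  (b) For every `δ ∈ [1/(2e), 1/2)`, with
`ε = ln(1/(2δ))/(2√n)`, that worst-case probability is at least `δ`. -/
theorem expectile_minimax_probability_lower_bound
    (ν : ℝ) (hν : ν ∈ Set.Ioo (0 : ℝ) 1) (n : ℕ) (hn : 1 ≤ n)
    (κ : ℝ) (hκ : ∫ x, lnu ν (x - κ) ∂(gaussianReal 0 1) = 0) :
    (∀ ε : ℝ, 0 < ε → Real.sqrt n * ε ≤ 1 / 2 →
      ∀ est : (Fin n → ℝ) → ℝ, Measurable est →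
        (ENNReal.ofReal ((1 / 2) * (1 - Real.sqrt n * ε))
          ≤ max
              ((Measure.pi fun _ : Fin n => gaussianReal ε 1)
                {x | ε ≤ |est x - (ε + κ)|})
              ((Measure.pi fun _ : Fin n => gaussianReal (-ε) 1)
                {x | ε ≤ |est x - (-ε + κ)|}))
        ∧ ENNReal.ofReal ((1 / 2) * Real.exp (-(2 * (Real.sqrt n * ε))))
            ≤ ENNReal.ofReal ((1 / 2) * (1 - Real.sqrt n * ε)))
    ∧ (∀ δ : ℝ, δ ∈ Set.Ico (1 / (2 * Real.exp 1)) (1 / 2) →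
        ∀ est : (Fin n → ℝ) → ℝ, Measurable est →
          ENNReal.ofReal δ
            ≤ max
                ((Measure.pi fun _ : Fin n =>
                    gaussianReal (Real.log (1 / (2 * δ)) / (2 * Real.sqrt n)) 1)
                  {x | Real.log (1 / (2 * δ)) / (2 * Real.sqrt n)
                    ≤ |est x - (Real.log (1 / (2 * δ)) / (2 * Real.sqrt n) + κ)|})
                ((Measure.pi fun _ : Fin n =>
                    gaussianReal (-(Real.log (1 / (2 * δ)) / (2 * Real.sqrt n))) 1)
                  {x | Real.log (1 / (2 * δ)) / (2 * Real.sqrt n)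
                    ≤ |est x - (-(Real.log (1 / (2 * δ)) / (2 * Real.sqrt n)) + κ)|})) := by
  have hbound : ∀ ε : ℝ, 0 < ε → √n * ε ≤ 1 / 2 →
      (1 / 2) * Real.exp (-(2 * (√n * ε))) ≤ (1 / 2) * (1 - √n * ε) := fun ε hε h =>
    mul_le_mul_of_nonneg_left (exp_neg_two_mul_le_one_sub (by positivity) h) (by norm_num)
  refine ⟨fun ε hε h est hest => ⟨le_max_measure_error_pi_gaussianReal n κ hε.le hest,
    ENNReal.ofReal_le_ofReal (hbound ε hε h)⟩, fun δ hδ est hest => ?_⟩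
  have hδ0 : 0 < δ := lt_of_lt_of_le (by positivity) hδ.1
  have hn0 : 0 < √(n : ℝ) := Real.sqrt_pos.2 (by exact_mod_cast hn)
  have hlog : 0 < Real.log (1 / (2 * δ)) := by
    refine Real.log_pos ?_
    rw [lt_div_iff₀ (by positivity)]
    linarith [hδ.2]
  have hlog1 : Real.log (1 / (2 * δ)) ≤ 1 := by
    rw [Real.log_le_iff_le_exp (by positivity), div_le_iff₀ (by positivity)]
    have := (div_le_iff₀ (by positivity)).1 hδ.1
    linarith
  have hscale : √n * (Real.log (1 / (2 * δ)) / (2 * √n)) = Real.log (1 / (2 * δ)) / 2 := by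
    field_simp
  set ε := Real.log (1 / (2 * δ)) / (2 * √n) with hε
  have hε0 : 0 < ε := by positivity
  have hδeq : δ = (1 / 2) * Real.exp (-(2 * (√n * ε))) := by
    rw [hscale, mul_div_cancel₀ _ two_ne_zero, Real.exp_neg, Real.exp_log (by positivity)]
    field_simp
  calc ENNReal.ofReal δ ≤ ENNReal.ofReal ((1 / 2) * (1 - √n * ε)) :=
        ENNReal.ofReal_le_ofReal (hδeq.le.trans (hbound ε hε0 (by linarith)))
    _ ≤ _ := le_max_measure_error_pi_gaussianReal n κ hε0.le hest
end

section
/- Fix ν ∈ (0,1) and n ≥ 1, and set ε = 1/(4√n). For every measurable estimator ξ̂ : ℝⁿ → ℝ, max over s ∈ {−1, +1} of E_{X ∼ N(sε,1)^{⊗n}} |ξ̂(X) − (sε + κ_ν)| ≥ 3/(32·√n), where X is a vector of n i.i.d. N(sε,1) samples. -/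
open MeasureTheory ProbabilityTheory

/-- A finite product of measures with densities has the product density. -/
lemma pi_withDensity_eq_withDensity_prod {ι : Type*} [Fintype ι] {E : ι → Type*}
    {mE : ∀ i, MeasurableSpace (E i)} {μ : ∀ i, Measure (E i)}
    [∀ i, IsProbabilityMeasure (μ i)] {f : ∀ i, E i → ENNReal} (hf : ∀ i, Measurable (f i))
    [∀ i, SigmaFinite ((μ i).withDensity (f i))] :
    Measure.pi (fun i => (μ i).withDensity (f i)) =
      (Measure.pi μ).withDensity (fun x => ∏ i, f i (x i)) := by
  classical
  refine Measure.pi_eq fun s hs => ?_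
  have hind (i : ι) : Measurable ((s i).indicator (f i)) := (hf i).indicator (hs i)
  have hprod : (Set.univ.pi s).indicator (fun x => ∏ i, f i (x i)) =
      fun x => ∏ i, (s i).indicator (f i) (x i) := by
    ext x
    by_cases hx : x ∈ Set.univ.pi s
    · rw [Set.indicator_of_mem hx]
      exact Finset.prod_congr rfl fun i _ =>
        (Set.indicator_of_mem (hx i (Set.mem_univ i)) _).symm
    · rw [Set.indicator_of_notMem hx]
      obtain ⟨i, hi⟩ : ∃ i, x i ∉ s i := by simpa [Set.mem_pi] using hx
      exact (Finset.prod_eq_zero (Finset.mem_univ i) (Set.indicator_of_notMem hi _)).symm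
  rw [withDensity_apply _ (MeasurableSet.univ_pi hs),
    ← lintegral_indicator (MeasurableSet.univ_pi hs), hprod,
    lintegral_prod_eq_prod_lintegral_of_indepFun Finset.univ
      (fun i (x : ∀ i, E i) => (s i).indicator (f i) (x i))
      (iIndepFun_pi fun i => (hind i).aemeasurable)
      (fun i => (hind i).comp (measurable_pi_apply i))]
  refine Finset.prod_congr rfl fun i _ => ?_
  rw [withDensity_apply _ (hs i), ← lintegral_indicator (hs i)]
  exact (measurePreserving_eval μ i).lintegral_comp (hind i)

/-- The density of `N(a,1)` with respect to the standard normal distribution. -/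
lemma gaussianReal_one_eq_withDensity (a : ℝ) :
    gaussianReal a 1 = (gaussianReal 0 1).withDensity
      (fun x => ENNReal.ofReal (Real.exp (a * x - a ^ 2 / 2))) := by
  rw [gaussianReal_of_var_ne_zero a one_ne_zero, gaussianReal_of_var_ne_zero 0 one_ne_zero,
    ← withDensity_mul _ (measurable_gaussianPDF 0 1) (by fun_prop)]
  congr 1
  ext x
  rw [Pi.mul_apply, gaussianPDF, gaussianPDF,
    ← ENNReal.ofReal_mul (gaussianPDFReal_nonneg 0 1 x), gaussianPDFReal, gaussianPDFReal,
    mul_assoc (Inv.inv _), ← Real.exp_add]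
  congr 3
  simp only [NNReal.coe_one]
  ring

/-- The density of `N(a,1)^{⊗n}` with respect to the standard normal product measure. -/
lemma pi_gaussianReal_one_eq_withDensity (n : ℕ) (a : ℝ) :
    Measure.pi (fun _ : Fin n => gaussianReal a 1) =
      (Measure.pi fun _ : Fin n => gaussianReal 0 1).withDensity
        (fun x => ENNReal.ofReal (Real.exp (a * ∑ i, x i - n * a ^ 2 / 2))) := by
  have : SigmaFinite ((gaussianReal 0 1).withDensity
      (fun x => ENNReal.ofReal (Real.exp (a * x - a ^ 2 / 2)))) := by
    rw [← gaussianReal_one_eq_withDensity]; infer_instance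
  rw [gaussianReal_one_eq_withDensity a,
    pi_withDensity_eq_withDensity_prod (fun _ => by fun_prop)]
  congr 1
  ext x
  rw [← ENNReal.ofReal_prod_of_nonneg (fun _ _ => (Real.exp_pos _).le), ← Real.exp_sum]
  congr 2
  rw [Finset.sum_sub_distrib, ← Finset.mul_sum]
  simp
  ring

/-- A pointwise two-point bound: the weighted sum of two errors that add up to at least `2ε` is
controlled from below through the product of the weights. -/
lemma two_point_weighted_bound {p q f g ε : ℝ} (hp : 0 < p) (hq : 0 < q) (hf : 0 ≤ f)
    (hg : 0 ≤ g) (hε : 0 ≤ ε) (hfg : 2 * ε ≤ f + g) :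
    2 * ε * (p * q) ≤ p * f + q * g + ε * (p * q) / 2 * (p + q) := by
  wlog hpq : p ≤ q generalizing p q f g
  · have := this hq hp hg hf (by linarith) (le_of_not_ge hpq)
    linarith [mul_comm p q, congrArg (fun t => ε * t / 2 * (p + q)) (mul_comm p q),
      congrArg (fun t => 2 * ε * t) (mul_comm p q)]
  have h1 : p * (2 * ε) ≤ p * f + q * g := by
    nlinarith [mul_le_mul_of_nonneg_left hfg hp.le, mul_le_mul_of_nonneg_right hpq hg]
  have h2 : 0 ≤ ε * p * (2 * (q / 2 - 1) ^ 2 + p * q / 2) := by positivity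
  nlinarith

/-- Le Cam's two-point bound for two probability measures with densities `p`, `q` whose product is
constant: the mean errors add up to at least `ε` times that constant. -/
lemma le_lintegral_add_lintegral_of_mul_eq {Ω : Type*} [MeasurableSpace Ω] {ρ : Measure Ω}
    [IsProbabilityMeasure ρ] {p q f g : Ω → ℝ} {ε c : ℝ} (hp : Measurable p) (hq : Measurable q)
    (hf : Measurable f) (hg : Measurable g) (hp0 : ∀ x, 0 < p x) (hq0 : ∀ x, 0 < q x)
    (hf0 : ∀ x, 0 ≤ f x) (hg0 : ∀ x, 0 ≤ g x) (hε : 0 ≤ ε) (hc : 0 ≤ c)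
    (hfg : ∀ x, 2 * ε ≤ f x + g x) (hpq : ∀ x, p x * q x = c)
    [IsProbabilityMeasure (ρ.withDensity fun x => ENNReal.ofReal (p x))]
    [IsProbabilityMeasure (ρ.withDensity fun x => ENNReal.ofReal (q x))] :
    ENNReal.ofReal (ε * c) ≤
      (∫⁻ x, ENNReal.ofReal (f x) ∂(ρ.withDensity fun x => ENNReal.ofReal (p x))) +
      ∫⁻ x, ENNReal.ofReal (g x) ∂(ρ.withDensity fun x => ENNReal.ofReal (q x)) := by
  have hp1 : ∫⁻ x, ENNReal.ofReal (p x) ∂ρ = 1 := by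
    rw [← setLIntegral_univ, ← withDensity_apply _ MeasurableSet.univ]
    exact measure_univ
  have hq1 : ∫⁻ x, ENNReal.ofReal (q x) ∂ρ = 1 := by
    rw [← setLIntegral_univ, ← withDensity_apply _ MeasurableSet.univ]
    exact measure_univ
  have hpt (x : Ω) : ENNReal.ofReal (2 * ε * c) ≤
      ENNReal.ofReal (p x) * ENNReal.ofReal (f x) + ENNReal.ofReal (q x) * ENNReal.ofReal (g x) +
        ENNReal.ofReal (ε * c / 2) * (ENNReal.ofReal (p x) + ENNReal.ofReal (q x)) := by
    have hx := two_point_weighted_bound (hp0 x) (hq0 x) (hf0 x) (hg0 x) hε (hfg x)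
    rw [hpq x] at hx
    have := hp0 x
    have := hq0 x
    have := hf0 x
    have := hg0 x
    rw [← ENNReal.ofReal_mul (by positivity), ← ENNReal.ofReal_mul (by positivity),
      ← ENNReal.ofReal_add (by positivity) (by positivity),
      ← ENNReal.ofReal_add (by positivity) (by positivity),
      ← ENNReal.ofReal_mul (by positivity),
      ← ENNReal.ofReal_add (by positivity) (by positivity)]
    exact ENNReal.ofReal_le_ofReal hx
  have hint := lintegral_mono (μ := ρ) hpt
  rw [lintegral_const, measure_univ, mul_one, lintegral_add_left (by fun_prop),
    lintegral_add_left (by fun_prop), lintegral_const_mul _ (by fun_prop),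
    lintegral_add_left (by fun_prop), hp1, hq1] at hint
  rw [lintegral_withDensity_eq_lintegral_mul _ (by fun_prop) (by fun_prop),
    lintegral_withDensity_eq_lintegral_mul _ (by fun_prop) (by fun_prop)]
  simp only [Pi.mul_apply]
  have h2 : ENNReal.ofReal (ε * c / 2) * (1 + 1) = ENNReal.ofReal (ε * c) := by
    rw [mul_add, mul_one, ← ENNReal.ofReal_add (by positivity) (by positivity), add_halves]
  have h3 : ENNReal.ofReal (2 * ε * c) = ENNReal.ofReal (ε * c) + ENNReal.ofReal (ε * c) := by
    rw [← ENNReal.ofReal_add (by positivity) (by positivity)]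
    congr 1
    ring
  rw [h2, h3] at hint
  exact (ENNReal.add_le_add_iff_right ENNReal.ofReal_ne_top).1 hint

/-- minimax lower bound in expectation for expectile estimation from `n`
i.i.d. Gaussian samples: with `ε = 1/(4√n)`, for every measurable estimator the worst of
the two mean absolute errors under `N(±ε,1)^{⊗n}` is at least `3/(32√n)`. -/
theorem expectile_minimax_expectation_lower_bound
    (ν : ℝ) (hν : ν ∈ Set.Ioo (0 : ℝ) 1) (n : ℕ) (hn : 1 ≤ n)
    (κ : ℝ) (hκ : ∫ x, lnu ν (x - κ) ∂(gaussianReal 0 1) = 0) :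
    ∀ est : (Fin n → ℝ) → ℝ, Measurable est →
      ENNReal.ofReal (3 / (32 * Real.sqrt n))
        ≤ max
            (∫⁻ x, ENNReal.ofReal |est x - (1 / (4 * Real.sqrt n) + κ)|
              ∂(Measure.pi fun _ : Fin n => gaussianReal (1 / (4 * Real.sqrt n)) 1))
            (∫⁻ x, ENNReal.ofReal |est x - (-(1 / (4 * Real.sqrt n)) + κ)|
              ∂(Measure.pi fun _ : Fin n => gaussianReal (-(1 / (4 * Real.sqrt n))) 1)) := by
  intro est hest
  have hn0 : (0 : ℝ) < n := by exact_mod_cast hn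
  have hs : 0 < Real.sqrt n := Real.sqrt_pos.2 hn0
  set ε : ℝ := 1 / (4 * Real.sqrt n) with hεdef
  have hε : 0 < ε := by positivity
  have hnε : n * ε ^ 2 = 1 / 16 := by
    rw [hεdef, div_pow, mul_pow, Real.sq_sqrt hn0.le]
    field_simp
    norm_num
  have hP : IsProbabilityMeasure (Measure.pi fun _ : Fin n => gaussianReal ε 1) := inferInstance
  have hQ : IsProbabilityMeasure (Measure.pi fun _ : Fin n => gaussianReal (-ε) 1) :=
    inferInstance
  rw [pi_gaussianReal_one_eq_withDensity] at hP hQ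
  rw [pi_gaussianReal_one_eq_withDensity n ε, pi_gaussianReal_one_eq_withDensity n (-ε)]
  have key := le_lintegral_add_lintegral_of_mul_eq
    (ρ := Measure.pi fun _ : Fin n => gaussianReal 0 1)
    (p := fun x => Real.exp (ε * ∑ i, x i - n * ε ^ 2 / 2))
    (q := fun x => Real.exp (-ε * ∑ i, x i - n * (-ε) ^ 2 / 2))
    (f := fun x => |est x - (ε + κ)|) (g := fun x => |est x - (-ε + κ)|)
    (ε := ε) (c := Real.exp (-(1 / 16)))
    (by fun_prop) (by fun_prop) (by fun_prop) (by fun_prop)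
    (fun _ => Real.exp_pos _) (fun _ => Real.exp_pos _)
    (fun _ => abs_nonneg _) (fun _ => abs_nonneg _) hε.le (Real.exp_pos _).le
    (fun x => by
      linarith [neg_abs_le (est x - (ε + κ)), le_abs_self (est x - (-ε + κ))])
    (fun x => by
      rw [← Real.exp_add]
      congr 1
      linear_combination -hnε)
  have hexp : 15 / 16 ≤ Real.exp (-(1 / 16)) := by
    linarith [Real.add_one_le_exp (-(1 / 16 : ℝ))]
  have hsum : ENNReal.ofReal (3 / (32 * Real.sqrt n)) + ENNReal.ofReal (3 / (32 * Real.sqrt n)) ≤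
      ENNReal.ofReal (ε * Real.exp (-(1 / 16))) := by
    rw [← ENNReal.ofReal_add (by positivity) (by positivity)]
    refine ENNReal.ofReal_le_ofReal ?_
    have h3 : 3 / (32 * Real.sqrt n) = 3 / 8 * ε := by
      rw [hεdef]
      field_simp
      norm_num
    rw [h3]
    nlinarith
  by_contra! hlt
  exact absurd (hsum.trans key)
    (not_le.2 (ENNReal.add_lt_add (lt_of_le_of_lt (le_max_left _ _) hlt)
      (lt_of_le_of_lt (le_max_right _ _) hlt)))
end

section
/- In the policy-gradient setting, fix ν ∈ (0,1), and for each θ ∈ Θ let ξ_ν(θ) denote the unique real number satisfying E_θ[l_ν(F − ξ_ν(θ))] = 0, where l_ν(x) = ν·x·1{x > 0} + (1 − ν)·x·1{x ≤ 0}. Assume P_θ(F = ξ_ν(θ)) = 0 for every θ ∈ Θ. Then θ ↦ ξ_ν(θ) is differentiable on Θ and ∇ξ_ν(θ) = E_θ[l_ν(F − ξ_ν(θ))·G(θ)] / E_θ[l'_ν(F − ξ_ν(θ))], where l'_ν(x) = ν·1{x > 0} + (1 − ν)·1{x ≤ 0}. -/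
open MeasureTheory

/-- The derivative `l'_ν(x) = ν·1{x > 0} + (1 − ν)·1{x ≤ 0}`. -/
noncomputable def lnu' (ν x : ℝ) : ℝ := if 0 < x then ν else 1 - ν

open Filter Topology Asymptotics

/-- A first-order expansion of `lnu` whose error is supported where `x` is within the increment
of the kink. -/
theorem abs_lnu_sub_add_mul_lnu'_le {ν : ℝ} (hν : ν ∈ Set.Ioo (0 : ℝ) 1) (x h : ℝ) :
    |lnu ν (x - h) - lnu ν x + h * lnu' ν x| ≤ |h| * if |x| ≤ |h| then 1 else 0 := by
  obtain ⟨h0, h1⟩ := hν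
  have hs (a : ℝ) (ha : |a| ≤ |h|) (c : ℝ) (hc : |c| ≤ 1) : |c * a| ≤ |h| := by
    rw [abs_mul]
    nlinarith [abs_nonneg a, abs_nonneg c]
  have hc : |2 * ν - 1| ≤ 1 := abs_le.2 ⟨by linarith, by linarith⟩
  unfold lnu lnu'
  by_cases hx : 0 < x <;> by_cases hxh : 0 < x - h <;> simp only [hx, hxh, if_true, if_false]
  · rw [show ν * (x - h) - ν * x + h * ν = 0 by ring, abs_zero]
    split_ifs <;> simp
  · have ha : |x| ≤ |h| := abs_le_abs (by linarith) (by linarith)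
    have hb : |h - x| ≤ |h| := by
      rw [abs_of_nonneg (by linarith), abs_of_nonneg (by linarith)]; linarith
    rw [if_pos ha, mul_one]
    convert hs (h - x) hb _ hc using 2
    ring
  · have ha : |x| ≤ |h| := by
      rw [abs_of_nonpos (by linarith), abs_of_nonpos (by linarith)]; linarith
    have hb : |x - h| ≤ |h| := by
      rw [abs_of_nonneg (by linarith), abs_of_nonpos (by linarith)]; linarith
    rw [if_pos ha, mul_one]
    convert hs (x - h) hb _ hc using 2
    ring
  · rw [show (1 - ν) * (x - h) - (1 - ν) * x + h * (1 - ν) = 0 by ring, abs_zero]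
    split_ifs <;> simp

theorem mul_sq_le_lnu_sub_mul {ν : ℝ} (hν : ν ∈ Set.Ioo (0 : ℝ) 1) (x h : ℝ) :
    ν * (1 - ν) * h ^ 2 ≤ (lnu ν x - lnu ν (x - h)) * h := by
  obtain ⟨h0, h1⟩ := hν
  have h2 : 0 < 1 - ν := by linarith
  have hm : ν * (1 - ν) ≤ ν := by nlinarith
  have hm' : ν * (1 - ν) ≤ 1 - ν := by nlinarith
  unfold lnu
  split_ifs with hx hxh hxh
  · nlinarith [mul_le_mul_of_nonneg_right hm (sq_nonneg h)]
  · have hh : 0 < h := by linarith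
    have : ν * (1 - ν) * h ≤ ν * x - (1 - ν) * (x - h) := by
      nlinarith [mul_le_mul_of_nonneg_right hm hx.le,
        mul_le_mul_of_nonneg_right hm' (show 0 ≤ h - x by linarith)]
    nlinarith
  · have hh : h < 0 := by linarith
    have : (1 - ν) * x - ν * (x - h) ≤ ν * (1 - ν) * h := by
      nlinarith [mul_le_mul_of_nonneg_right hm hxh.le,
        mul_le_mul_of_nonneg_right hm' (show 0 ≤ -x by linarith)]
    nlinarith
  · nlinarith [mul_le_mul_of_nonneg_right hm' (sq_nonneg h)]

theorem measurable_lnu (ν : ℝ) : Measurable (lnu ν) :=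
  Measurable.ite measurableSet_Ioi (measurable_id.const_mul _) (measurable_id.const_mul _)

theorem measurable_lnu' (ν : ℝ) : Measurable (lnu' ν) :=
  Measurable.ite measurableSet_Ioi measurable_const measurable_const

theorem abs_lnu_le {ν : ℝ} (hν : ν ∈ Set.Ioo (0 : ℝ) 1) (x : ℝ) : |lnu ν x| ≤ |x| := by
  obtain ⟨h0, h1⟩ := hν
  unfold lnu
  split_ifs <;> rw [abs_mul] <;> refine mul_le_of_le_one_left (abs_nonneg x) ?_ <;>
    exact abs_le.2 ⟨by linarith, by linarith⟩

theorem abs_lnu'_le_one {ν : ℝ} (hν : ν ∈ Set.Ioo (0 : ℝ) 1) (x : ℝ) : |lnu' ν x| ≤ 1 := by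
  obtain ⟨h0, h1⟩ := hν
  unfold lnu'
  split_ifs <;> exact abs_le.2 ⟨by linarith, by linarith⟩

theorem mul_one_sub_le_lnu' {ν : ℝ} (hν : ν ∈ Set.Ioo (0 : ℝ) 1) (x : ℝ) :
    ν * (1 - ν) ≤ lnu' ν x := by
  obtain ⟨h0, h1⟩ := hν
  unfold lnu'
  split_ifs <;> nlinarith

/-- The mass of the `δ`-neighbourhood of a null level set vanishes as `δ → 0`. -/
theorem exists_integral_abs_le_mul_lt {T : Type*} [MeasurableSpace T] {μ : Measure T}
    {q X : T → ℝ} (hq : Integrable q μ) (hX : Measurable X) (hX0 : ∀ᵐ τ ∂μ, X τ ≠ 0)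
    {ε : ℝ} (hε : 0 < ε) :
    ∃ δ > 0, ∫ τ, (if |X τ| ≤ δ then 1 else 0) * q τ ∂μ < ε := by
  have hlim : Tendsto (fun δ : ℝ => ∫ τ, (if |X τ| ≤ δ then 1 else 0) * q τ ∂μ)
      (𝓝[>] 0) (𝓝 (∫ _, (0 : ℝ) ∂μ)) := by
    refine tendsto_integral_filter_of_dominated_convergence (fun τ => ‖q τ‖) ?_ ?_ hq.norm ?_
    · refine Eventually.of_forall fun δ => ?_
      exact (Measurable.ite (measurableSet_le hX.abs measurable_const) measurable_const
        measurable_const).aestronglyMeasurable.mul hq.aestronglyMeasurable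
    · refine Eventually.of_forall fun δ => Eventually.of_forall fun τ => ?_
      split_ifs <;> simp
    · filter_upwards [hX0] with τ hτ
      refine tendsto_const_nhds.congr' ?_
      filter_upwards [mem_nhdsWithin_of_mem_nhds (Iio_mem_nhds (abs_pos.2 hτ))] with δ hδ
      rw [if_neg (not_le.2 hδ), zero_mul]
  rw [integral_zero] at hlim
  obtain ⟨δ, hδ, hδ0⟩ := ((hlim.eventually (Iio_mem_nhds hε)).and self_mem_nhdsWithin).exists
  exact ⟨δ, hδ0, hδ⟩

/-- policy gradient theorem for expectiles.  In the policy-gradient setting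
(densities `p θ` w.r.t. a σ-finite measure `μ0` on the trajectory space, bounded return
`F`, bounded score `g(θ,τ) = (p θ τ)⁻¹ • ∇_θ p(θ,τ)`, and validity of differentiation
under the integral sign in `θ`), if `ξ θ` denotes the unique root of
`E_θ[l_ν(F − ·)] = 0` and `P_θ(F = ξ θ) = 0`, then `ξ` is differentiable on `Θ` with
`∇ξ(θ) = E_θ[l_ν(F − ξ θ)·G(θ)] / E_θ[l'_ν(F − ξ θ)]`. -/
theorem policy_gradient_expectile
    {d : ℕ} {T : Type*} [MeasurableSpace T] (μ0 : Measure T) [SigmaFinite μ0]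
    (Θ : Set (EuclideanSpace ℝ (Fin d))) (hΘopen : IsOpen Θ) (hΘconv : Convex ℝ Θ)
    (p : EuclideanSpace ℝ (Fin d) → T → ℝ)
    (hpmeas : ∀ θ, Measurable (p θ))
    (hppos : ∀ θ ∈ Θ, ∀ τ, 0 < p θ τ)
    (hpdens : ∀ θ ∈ Θ, ∫ τ, p θ τ ∂μ0 = 1)
    (Dp : EuclideanSpace ℝ (Fin d) → T → EuclideanSpace ℝ (Fin d))
    (hpdiff : ∀ τ, ∀ θ ∈ Θ, HasGradientAt (fun θ' => p θ' τ) (Dp θ τ) θ)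
    (hDpcont : ∀ τ, ContinuousOn (fun θ => Dp θ τ) Θ)
    (F : T → ℝ) (hFmeas : Measurable F)
    (Fmax : ℝ) (hFbd : ∀ τ, |F τ| ≤ Fmax)
    (S : ℝ) (hscore : ∀ θ ∈ Θ, ∀ τ, ‖(p θ τ)⁻¹ • Dp θ τ‖ ≤ S)
    (hswap : ∀ θ ∈ Θ, ∀ f : T → ℝ, Measurable f → (∃ B, ∀ τ, |f τ| ≤ B) →
      HasGradientAt (fun θ' => ∫ τ, f τ * p θ' τ ∂μ0) (∫ τ, f τ • Dp θ τ ∂μ0) θ)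
    (ν : ℝ) (hν : ν ∈ Set.Ioo (0 : ℝ) 1)
    (ξ : EuclideanSpace ℝ (Fin d) → ℝ)
    (hξroot : ∀ θ ∈ Θ, ∫ τ, lnu ν (F τ - ξ θ) * p θ τ ∂μ0 = 0)
    (hξuniq : ∀ θ ∈ Θ, ∀ k : ℝ, (∫ τ, lnu ν (F τ - k) * p θ τ ∂μ0 = 0) → k = ξ θ)
    (hcont : ∀ θ ∈ Θ,
      (μ0.withDensity fun τ => ENNReal.ofReal (p θ τ)) {τ | F τ = ξ θ} = 0) :
    ∀ θ ∈ Θ, HasGradientAt ξ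
      ((∫ τ, lnu' ν (F τ - ξ θ) * p θ τ ∂μ0)⁻¹ •
        ∫ τ, lnu ν (F τ - ξ θ) • Dp θ τ ∂μ0) θ := by
  intro θ₀ hθ₀
  have hint (θ) (hθ : θ ∈ Θ) : Integrable (p θ) μ0 :=
    Integrable.of_integral_ne_zero (by rw [hpdens θ hθ]; exact one_ne_zero)
  have hmul (θ) (hθ : θ ∈ Θ) (f : T → ℝ) (hf : Measurable f) (B : ℝ) (hB : ∀ τ, |f τ| ≤ B) :
      Integrable (fun τ => f τ * p θ τ) μ0 :=
    (hint θ hθ).bdd_mul hf.aestronglyMeasurable (Eventually.of_forall hB)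
  have hX (k : ℝ) : Measurable fun τ => F τ - k := hFmeas.sub_const k
  have hl (k : ℝ) : Measurable fun τ => lnu ν (F τ - k) := (measurable_lnu ν).comp (hX k)
  have hlb (k : ℝ) (τ) : |lnu ν (F τ - k)| ≤ Fmax + |k| :=
    (abs_lnu_le hν _).trans ((abs_sub _ _).trans (by gcongr; exact hFbd τ))
  have hl' : Measurable fun τ => lnu' ν (F τ - ξ θ₀) := (measurable_lnu' ν).comp (hX _)
  have hlb' (τ) : |lnu' ν (F τ - ξ θ₀)| ≤ 1 := abs_lnu'_le_one hν _
  have hind (δ : ℝ) : Measurable fun τ => if |F τ - ξ θ₀| ≤ δ then (1 : ℝ) else 0 :=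
    Measurable.ite (measurableSet_le (hX _).abs measurable_const) measurable_const
      measurable_const
  have hindb (δ : ℝ) (τ) : |if |F τ - ξ θ₀| ≤ δ then (1 : ℝ) else 0| ≤ 1 := by
    split_ifs <;> simp
  have hΘ : ∀ᶠ θ in 𝓝 θ₀, θ ∈ Θ := hΘopen.mem_nhds hθ₀
  have hm : 0 < ν * (1 - ν) := mul_pos hν.1 (by linarith [hν.2])
  set Φ : EuclideanSpace ℝ (Fin d) → ℝ := fun θ => ∫ τ, lnu ν (F τ - ξ θ₀) * p θ τ ∂μ0
  set B : EuclideanSpace ℝ (Fin d) → ℝ := fun θ => ∫ τ, lnu' ν (F τ - ξ θ₀) * p θ τ ∂μ0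
  set V := ∫ τ, lnu ν (F τ - ξ θ₀) • Dp θ₀ τ ∂μ0
  have hΦgrad : HasGradientAt Φ V θ₀ := hswap θ₀ hθ₀ _ (hl _) ⟨_, hlb _⟩
  have hBcont : Tendsto B (𝓝 θ₀) (𝓝 (B θ₀)) :=
    (hswap θ₀ hθ₀ _ hl' ⟨1, hlb'⟩).hasFDerivAt.continuousAt
  have hB0 : B θ₀ ≠ 0 := by
    refine (hm.trans_le ?_).ne'
    calc ν * (1 - ν) = ∫ τ, ν * (1 - ν) * p θ₀ τ ∂μ0 := by
          rw [integral_const_mul, hpdens θ₀ hθ₀, mul_one]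
      _ ≤ B θ₀ := integral_mono ((hint θ₀ hθ₀).const_mul _) (hmul θ₀ hθ₀ _ hl' 1 hlb')
          fun τ => mul_le_mul_of_nonneg_right (mul_one_sub_le_lnu' hν _) (hppos θ₀ hθ₀ τ).le
  have hΦ0 : Φ θ₀ = 0 := hξroot θ₀ hθ₀
  have hΦO : Φ =O[𝓝 θ₀] fun θ => θ - θ₀ := by
    simpa [hΦ0] using hΦgrad.hasFDerivAt.isBigO_sub
  have hξbd (θ) (hθ : θ ∈ Θ) : ν * (1 - ν) * |ξ θ - ξ θ₀| ≤ |Φ θ| := by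
    set h := ξ θ - ξ θ₀ with hh
    have hle : ν * (1 - ν) * h ^ 2 ≤ Φ θ * h := by
      calc ν * (1 - ν) * h ^ 2 = ∫ τ, ν * (1 - ν) * h ^ 2 * p θ τ ∂μ0 := by
            rw [integral_const_mul, hpdens θ hθ, mul_one]
        _ ≤ ∫ τ, (lnu ν (F τ - ξ θ₀) * p θ τ - lnu ν (F τ - ξ θ) * p θ τ) * h ∂μ0 := by
            refine integral_mono ((hint θ hθ).const_mul _)
              (((hmul θ hθ _ (hl _) _ (hlb _)).sub (hmul θ hθ _ (hl _) _ (hlb _))).mul_const h)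
              fun τ => ?_
            have := mul_le_mul_of_nonneg_right
              (mul_sq_le_lnu_sub_mul hν (F τ - ξ θ₀) h) (hppos θ hθ τ).le
            rw [hh, sub_sub_sub_cancel_right, ← hh] at this
            exact this.trans_eq (by ring)
        _ = Φ θ * h := by
            rw [integral_mul_const, integral_sub (hmul θ hθ _ (hl _) _ (hlb _))
              (hmul θ hθ _ (hl _) _ (hlb _)), hξroot θ hθ, sub_zero]
    rcases eq_or_ne h 0 with h0 | h0
    · simp [h0]
    · refine le_of_mul_le_mul_right ?_ (abs_pos.2 h0)
      rw [mul_assoc, ← sq, sq_abs, ← abs_mul]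
      exact hle.trans (le_abs_self _)
  have hξO : (fun θ => ξ θ - ξ θ₀) =O[𝓝 θ₀] fun θ => θ - θ₀ := by
    refine IsBigO.trans (IsBigO.of_bound (ν * (1 - ν))⁻¹ ?_) hΦO
    filter_upwards [hΘ] with θ hθ
    rw [Real.norm_eq_abs, Real.norm_eq_abs, inv_mul_eq_div, le_div_iff₀' hm]
    exact hξbd θ hθ
  have hξcont : Tendsto (fun θ => |ξ θ - ξ θ₀|) (𝓝 θ₀) (𝓝 0) := by
    have : Tendsto (fun θ => θ - θ₀) (𝓝 θ₀) (𝓝 0) := by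
      simpa using (continuous_id.sub continuous_const).tendsto (x := θ₀) (f := fun θ => θ - θ₀)
    simpa using (hξO.trans_tendsto this).abs
  have hne : ∀ᵐ τ ∂μ0, F τ - ξ θ₀ ≠ 0 := by
    have h0 := hcont θ₀ hθ₀
    rw [withDensity_apply_eq_zero' (hpmeas θ₀).ennreal_ofReal.aemeasurable] at h0
    refine measure_mono_null (fun τ hτ => ?_) h0
    exact ⟨(ENNReal.ofReal_pos.2 (hppos θ₀ hθ₀ τ)).ne', sub_eq_zero.1 (not_not.1 hτ)⟩
  have hrem (θ) (hθ : θ ∈ Θ) : |(ξ θ - ξ θ₀) * B θ - Φ θ| ≤ |ξ θ - ξ θ₀| *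
      ∫ τ, (if |F τ - ξ θ₀| ≤ |ξ θ - ξ θ₀| then 1 else 0) * p θ τ ∂μ0 := by
    set h := ξ θ - ξ θ₀ with hh
    have hi₁ := hmul θ hθ _ (hl (ξ θ)) _ (hlb _)
    have hi₂ := hmul θ hθ _ (hl (ξ θ₀)) _ (hlb _)
    have hi₃ := (hmul θ hθ _ hl' 1 hlb').const_mul h
    have heq : h * B θ - Φ θ = ∫ τ, (lnu ν (F τ - ξ θ) * p θ τ - lnu ν (F τ - ξ θ₀) * p θ τ)
        + h * (lnu' ν (F τ - ξ θ₀) * p θ τ) ∂μ0 := by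
      rw [integral_add (by exact hi₁.sub hi₂) hi₃, integral_sub hi₁ hi₂, integral_const_mul,
        hξroot θ hθ]
      ring
    rw [heq, ← integral_const_mul, ← Real.norm_eq_abs]
    refine norm_integral_le_of_norm_le ((hmul θ hθ _ (hind _) 1 (hindb _)).const_mul _)
      (Eventually.of_forall fun τ => ?_)
    have := mul_le_mul_of_nonneg_right
      (abs_lnu_sub_add_mul_lnu'_le hν (F τ - ξ θ₀) h) (hppos θ hθ τ).le
    rw [hh, sub_sub_sub_cancel_right, ← hh] at this
    rw [Real.norm_eq_abs, ← sub_mul, ← mul_assoc, ← add_mul, abs_mul,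
      abs_of_pos (hppos θ hθ τ), ← mul_assoc]
    exact this
  have hlin : (fun θ => (ξ θ - ξ θ₀) * B θ - Φ θ) =o[𝓝 θ₀] fun θ => ξ θ - ξ θ₀ := by
    refine IsLittleO.of_bound fun ε hε => ?_
    obtain ⟨δ, hδ, hδε⟩ := exists_integral_abs_le_mul_lt (hint θ₀ hθ₀) (hX _) hne hε
    have hH : ∀ᶠ θ in 𝓝 θ₀, ∫ τ, (if |F τ - ξ θ₀| ≤ δ then 1 else 0) * p θ τ ∂μ0 < ε :=
      (hswap θ₀ hθ₀ _ (hind δ) ⟨1, hindb δ⟩).hasFDerivAt.continuousAt.eventually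
        (Iio_mem_nhds hδε)
    filter_upwards [hΘ, hH, hξcont.eventually (Iio_mem_nhds hδ)] with θ hθ hθH hθδ
    rw [Real.norm_eq_abs, Real.norm_eq_abs, mul_comm ε]
    refine (hrem θ hθ).trans (mul_le_mul_of_nonneg_left (le_trans ?_ hθH.le) (abs_nonneg _))
    refine integral_mono (hmul θ hθ _ (hind _) 1 (hindb _)) (hmul θ hθ _ (hind _) 1 (hindb _))
      fun τ => mul_le_mul_of_nonneg_right ?_ (hppos θ hθ τ).le
    have hθδ' : |ξ θ - ξ θ₀| < δ := hθδ
    split_ifs with h₁ h₂ <;> first | exact absurd (h₁.trans hθδ'.le) h₂ | norm_num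
  have hBξ : (fun θ => (B θ₀ - B θ) * (ξ θ - ξ θ₀)) =o[𝓝 θ₀] fun θ => ξ θ - ξ θ₀ := by
    have hB1 : (fun θ => B θ₀ - B θ) =o[𝓝 θ₀] fun _ => (1 : ℝ) :=
      (isLittleO_one_iff ℝ).2 (by simpa using hBcont.const_sub (B θ₀))
    simpa using hB1.mul_isBigO (isBigO_refl (fun θ => ξ θ - ξ θ₀) (𝓝 θ₀))
  have hΦo : (fun θ => Φ θ - inner ℝ V (θ - θ₀)) =o[𝓝 θ₀] fun θ => θ - θ₀ := by
    simpa [hΦ0] using hasGradientAt_iff_isLittleO.1 hΦgrad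
  change HasGradientAt ξ ((B θ₀)⁻¹ • V) θ₀
  rw [hasGradientAt_iff_isLittleO]
  refine ((((hlin.add hBξ).trans_isBigO hξO).add hΦo).const_mul_left (B θ₀)⁻¹).congr_left
    fun θ => ?_
  rw [real_inner_smul_left]
  field_simp
  ring
end

section
/- In the policy-gradient setting, let l : ℝ → ℝ be convex, strictly increasing and continuously differentiable, and let λ ∈ ℝ be such that for every θ ∈ Θ there exists k ∈ ℝ with E_θ[l(F − k)] = λ. Define the utility-based shortfall risk SR(θ) = inf{ k ∈ ℝ : E_θ[l(F − k)] ≤ λ }. Then θ ↦ SR(θ) is differentiable on Θ and ∇SR(θ) = E_θ[l(F − SR(θ))·G(θ)] / E_θ[l'(F − SR(θ))]. -/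
open MeasureTheory

open Filter Topology Asymptotics

section Calculus

/-- If `f` vanishes at `x` and `g` is squeezed between `f * lo` and `f * hi`, where `lo` and `hi`
both tend to `m ≠ 0`, then a gradient of `g` yields one of `f`. -/
theorem HasGradientAt.of_mul_le_of_le_mul {E : Type*} [NormedAddCommGroup E]
    [InnerProductSpace ℝ E] [CompleteSpace E] {f g lo hi : E → ℝ} {m : ℝ} {a x : E}
    (hg : HasGradientAt g a x) (hfx : f x = 0)
    (hlo : ∀ᶠ y in 𝓝 x, f y * lo y ≤ g y) (hhi : ∀ᶠ y in 𝓝 x, g y ≤ f y * hi y)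
    (hlom : Tendsto lo (𝓝 x) (𝓝 m)) (hhim : Tendsto hi (𝓝 x) (𝓝 m)) (hm : m ≠ 0) :
    HasGradientAt f (m⁻¹ • a) x := by
  have hgx : g x = 0 := by
    have h1 := hlo.self_of_nhds
    have h2 := hhi.self_of_nhds
    simp only [hfx, zero_mul] at h1 h2
    exact le_antisymm h2 h1
  have herr : (fun y => g y - m * f y) =o[𝓝 x] f := by
    have hsmall : (fun y => (|lo y - m| + |hi y - m|) * f y) =o[𝓝 x] f := by
      have h0 : (fun y => |lo y - m| + |hi y - m|) =o[𝓝 x] (fun _ => (1 : ℝ)) := by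
        rw [isLittleO_one_iff]
        simpa using (hlom.sub_const m).abs.add (hhim.sub_const m).abs
      simpa using h0.mul_isBigO (isBigO_refl f _)
    refine IsBigO.trans_isLittleO (IsBigO.of_bound 1 ?_) hsmall
    filter_upwards [hlo, hhi] with y h1 h2
    have e1 : |f y * (lo y - m)| = |f y| * |lo y - m| := abs_mul _ _
    have e2 : |f y * (hi y - m)| = |f y| * |hi y - m| := abs_mul _ _
    have n1 := neg_abs_le (f y * (lo y - m))
    have n2 := le_abs_self (f y * (hi y - m))
    have p1 := mul_nonneg (abs_nonneg (f y)) (abs_nonneg (lo y - m))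
    have p2 := mul_nonneg (abs_nonneg (f y)) (abs_nonneg (hi y - m))
    rw [one_mul, Real.norm_eq_abs, Real.norm_eq_abs, abs_mul,
      abs_of_nonneg (add_nonneg (abs_nonneg (lo y - m)) (abs_nonneg (hi y - m))), abs_le]
    constructor <;> nlinarith
  have hfg : f =O[𝓝 x] g := by
    have h := (herr.trans_isBigO (isBigO_self_const_mul hm f (𝓝 x))).right_isBigO_add
    simp only [sub_add_cancel] at h
    exact (isBigO_self_const_mul hm f (𝓝 x)).trans h
  rw [hasGradientAt_iff_isLittleO] at hg ⊢
  have hgO : g =O[𝓝 x] fun y => y - x := by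
    have hinner : (fun y => inner ℝ a (y - x)) =O[𝓝 x] fun y => y - x :=
      IsBigO.of_bound ‖a‖ (Eventually.of_forall fun y => norm_inner_le_norm a (y - x))
    simpa [hgx] using hg.isBigO.add hinner
  have h := (hg.sub (herr.trans_isBigO (hfg.trans hgO))).const_mul_left m⁻¹
  refine h.congr_left fun y => ?_
  rw [hgx, hfx, real_inner_smul_left]
  field_simp
  ring

/-- Joint continuity along a curve for functions that are separately continuous and antitone in
the second variable. -/
theorem tendsto_apply_of_antitone {E : Type*} [TopologicalSpace E] {N : E → ℝ → ℝ} {s : E → ℝ}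
    {x : E} (hanti : ∀ᶠ y in 𝓝 x, Antitone (N y)) (hN : ∀ k, ContinuousAt (fun y => N y k) x)
    (hNx : ContinuousAt (N x) (s x)) (hs : ContinuousAt s x) :
    Tendsto (fun y => N y (s y)) (𝓝 x) (𝓝 (N x (s x))) := by
  have hnear (ε : ℝ) (hε : 0 < ε) : ∃ δ > 0, ∀ k, |k - s x| < δ → |N x k - N x (s x)| < ε := by
    simpa [Real.dist_eq] using Metric.continuousAt_iff.1 hNx ε hε
  refine tendsto_order.2 ⟨fun a ha => ?_, fun b hb => ?_⟩
  · obtain ⟨δ, hδ, h⟩ := hnear _ (sub_pos.2 ha)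
    have hk := h (s x + δ / 2) (by rw [add_sub_cancel_left, abs_of_pos] <;> linarith)
    have hk' : a < N x (s x + δ / 2) := by linarith [(abs_lt.1 hk).1]
    filter_upwards [hanti, (hN _).eventually (lt_mem_nhds hk'),
      hs.eventually (gt_mem_nhds (show s x < s x + δ / 2 by linarith))] with y h1 h2 h3
    exact h2.trans_le (h1 h3.le)
  · obtain ⟨δ, hδ, h⟩ := hnear _ (sub_pos.2 hb)
    have hk := h (s x - δ / 2) (by rw [sub_sub_cancel_left, abs_neg, abs_of_pos] <;> linarith)
    have hk' : N x (s x - δ / 2) < b := by linarith [(abs_lt.1 hk).2]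
    filter_upwards [hanti, (hN _).eventually (gt_mem_nhds hk'),
      hs.eventually (lt_mem_nhds (show s x - δ / 2 < s x by linarith))] with y h1 h2 h3
    exact (h1 h3.le).trans_lt h2

/-- The root of a strictly antitone function depends continuously on parameters. -/
theorem continuousAt_root_of_strictAnti {E : Type*} [TopologicalSpace E] {N : E → ℝ → ℝ}
    {s : E → ℝ} {x : E} {c : ℝ} (hanti : ∀ᶠ y in 𝓝 x, StrictAnti (N y))
    (hN : ∀ k, ContinuousAt (fun y => N y k) x) (hroot : ∀ᶠ y in 𝓝 x, N y (s y) = c) :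
    ContinuousAt s x := by
  refine tendsto_order.2 ⟨fun a ha => ?_, fun b hb => ?_⟩
  · have h : c < N x a := hroot.self_of_nhds ▸ hanti.self_of_nhds ha
    filter_upwards [hanti, hroot, (hN a).eventually (lt_mem_nhds h)] with y h1 h2 h3
    exact h1.lt_iff_gt.1 (h2 ▸ h3)
  · have h : N x b < c := hroot.self_of_nhds ▸ hanti.self_of_nhds hb
    filter_upwards [hanti, hroot, (hN b).eventually (gt_mem_nhds h)] with y h1 h2 h3
    exact h1.lt_iff_gt.1 (h2 ▸ h3)

theorem StrictAnti.sInf_setOf_le {f : ℝ → ℝ} (hf : StrictAnti f) {k c : ℝ} (hk : f k = c) :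
    sInf {x | f x ≤ c} = k := by
  have : {x | f x ≤ c} = Set.Ici k := by
    ext x
    rw [Set.mem_ofPred_eq, ← hk, hf.le_iff_ge, Set.mem_Ici]
  rw [this, csInf_Ici]

theorem ConvexOn.mul_sub_le_sub_of_hasDerivAt {l l' : ℝ → ℝ} (hl : ConvexOn ℝ Set.univ l)
    (hl' : ∀ x, HasDerivAt l (l' x) x) (x y : ℝ) : l' x * (y - x) ≤ l y - l x := by
  rcases lt_trichotomy x y with h | rfl | h
  · have := hl.le_slope_of_hasDerivAt (Set.mem_univ x) (Set.mem_univ y) h (hl' x)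
    rwa [slope_def_field, le_div_iff₀ (sub_pos.2 h)] at this
  · simp
  · have := hl.slope_le_of_hasDerivAt (Set.mem_univ y) (Set.mem_univ x) h (hl' x)
    rw [slope_def_field, div_le_iff₀ (sub_pos.2 h)] at this
    linarith

end Calculus

section ShiftedExpectation

variable {T : Type*} {F : T → ℝ} {Fmax : ℝ}

theorem exists_forall_abs_comp_sub_le (hF : ∀ τ, |F τ| ≤ Fmax) {φ : ℝ → ℝ} (hφ : Continuous φ)
    (k₀ r : ℝ) : ∃ B, ∀ k, |k - k₀| ≤ r → ∀ τ, |φ (F τ - k)| ≤ B := by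
  obtain ⟨B, hB⟩ := (isCompact_Icc (a := -Fmax - k₀ - r)
    (b := Fmax - k₀ + r)).exists_bound_of_continuousOn
    hφ.continuousOn
  refine ⟨B, fun k hk τ => hB _ ?_⟩
  have h1 := abs_le.1 hk
  have h2 := abs_le.1 (hF τ)
  constructor <;> linarith [h1.1, h1.2, h2.1, h2.2]

theorem exists_abs_comp_sub_le (hF : ∀ τ, |F τ| ≤ Fmax) {φ : ℝ → ℝ} (hφ : Continuous φ)
    (k : ℝ) : ∃ B, ∀ τ, |φ (F τ - k)| ≤ B :=
  (exists_forall_abs_comp_sub_le hF hφ k 0).imp fun _ hB => hB k (by simp)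

variable [MeasurableSpace T] {μ : Measure T} {q : T → ℝ}

theorem integrable_comp_sub_mul (hFm : Measurable F) (hF : ∀ τ, |F τ| ≤ Fmax) {φ : ℝ → ℝ}
    (hφ : Continuous φ) (hq : Integrable q μ) (k : ℝ) :
    Integrable (fun τ => φ (F τ - k) * q τ) μ := by
  obtain ⟨B, hB⟩ := exists_abs_comp_sub_le hF hφ k
  exact hq.bdd_mul (hφ.measurable.comp (hFm.sub_const k)).aestronglyMeasurable
    (Eventually.of_forall hB)

theorem continuous_integral_comp_sub_mul (hFm : Measurable F) (hF : ∀ τ, |F τ| ≤ Fmax)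
    {φ : ℝ → ℝ} (hφ : Continuous φ) (hq : Integrable q μ) :
    Continuous fun k => ∫ τ, φ (F τ - k) * q τ ∂μ := by
  refine continuous_iff_continuousAt.2 fun k₀ => ?_
  obtain ⟨B, hB⟩ := exists_forall_abs_comp_sub_le hF hφ k₀ 1
  refine continuousAt_of_dominated (bound := fun τ => B * |q τ|)
    (Eventually.of_forall fun k => (integrable_comp_sub_mul hFm hF hφ hq k).aestronglyMeasurable)
    ?_ (hq.abs.const_mul B) (Eventually.of_forall fun τ => by fun_prop)
  filter_upwards [Metric.closedBall_mem_nhds k₀ one_pos] with k hk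
  refine Eventually.of_forall fun τ => ?_
  rw [norm_mul, Real.norm_eq_abs, Real.norm_eq_abs]
  exact mul_le_mul_of_nonneg_right (hB k hk τ) (abs_nonneg _)

theorem antitone_integral_comp_sub_mul (hFm : Measurable F) (hF : ∀ τ, |F τ| ≤ Fmax)
    {φ : ℝ → ℝ} (hφ : Continuous φ) (hmono : Monotone φ) (hq : Integrable q μ)
    (hq0 : ∀ τ, 0 ≤ q τ) : Antitone fun k => ∫ τ, φ (F τ - k) * q τ ∂μ := fun k₁ k₂ h =>
  integral_mono (integrable_comp_sub_mul hFm hF hφ hq k₂) (integrable_comp_sub_mul hFm hF hφ hq k₁)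
    fun τ => mul_le_mul_of_nonneg_right (hmono (by linarith)) (hq0 τ)

theorem integral_comp_sub_mul_pos (hFm : Measurable F) (hF : ∀ τ, |F τ| ≤ Fmax)
    {φ : ℝ → ℝ} (hφ : Continuous φ) (hmono : Monotone φ) (hpos : ∀ x, 0 < φ x)
    (hq : Integrable q μ) (hq0 : ∀ τ, 0 ≤ q τ) (hq1 : ∫ τ, q τ ∂μ = 1) (k : ℝ) :
    0 < ∫ τ, φ (F τ - k) * q τ ∂μ := by
  have h : ∫ τ, φ (-Fmax - k) * q τ ∂μ ≤ ∫ τ, φ (F τ - k) * q τ ∂μ :=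
    integral_mono (hq.const_mul _) (integrable_comp_sub_mul hFm hF hφ hq k) fun τ =>
      mul_le_mul_of_nonneg_right (hmono (by linarith [(abs_le.1 (hF τ)).1])) (hq0 τ)
  rw [integral_const_mul, hq1, mul_one] at h
  exact (hpos _).trans_le h

theorem mul_integral_deriv_le_sub {l l' : ℝ → ℝ} (hFm : Measurable F) (hF : ∀ τ, |F τ| ≤ Fmax)
    (hl : ConvexOn ℝ Set.univ l) (hl' : ∀ x, HasDerivAt l (l' x) x) (hc : Continuous l')
    (hq : Integrable q μ) (hq0 : ∀ τ, 0 ≤ q τ) (k₁ k₂ : ℝ) :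
    (k₂ - k₁) * ∫ τ, l' (F τ - k₂) * q τ ∂μ ≤
      (∫ τ, l (F τ - k₁) * q τ ∂μ) - ∫ τ, l (F τ - k₂) * q τ ∂μ := by
  have hlc : Continuous l := continuous_iff_continuousAt.2 fun x => (hl' x).continuousAt
  have h₁ := integrable_comp_sub_mul hFm hF hlc hq k₁
  have h₂ := integrable_comp_sub_mul hFm hF hlc hq k₂
  rw [← integral_sub h₁ h₂, ← integral_const_mul]
  refine integral_mono ((integrable_comp_sub_mul hFm hF hc hq k₂).const_mul _) (h₁.sub h₂)
    fun τ => ?_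
  have h := mul_le_mul_of_nonneg_right
    (hl.mul_sub_le_sub_of_hasDerivAt hl' (F τ - k₂) (F τ - k₁)) (hq0 τ)
  simp only
  linarith

end ShiftedExpectation

/-- policy gradient theorem for utility-based shortfall risk.  In the
policy-gradient setting, with a convex strictly-increasing continuously differentiable
loss `l` (derivative `l'`) and threshold `λ` such that for each `θ ∈ Θ` the root equation
`E_θ[l(F − k)] = λ` is solvable, the UBSR `SR(θ) = inf{k : E_θ[l(F − k)] ≤ λ}` is
differentiable on `Θ` with
`∇SR(θ) = E_θ[l(F − SR(θ))·G(θ)] / E_θ[l'(F − SR(θ))]`. -/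
theorem policy_gradient_ubsr
    {d : ℕ} {T : Type*} [MeasurableSpace T] (μ0 : Measure T) [SigmaFinite μ0]
    (Θ : Set (EuclideanSpace ℝ (Fin d))) (hΘopen : IsOpen Θ) (hΘconv : Convex ℝ Θ)
    (p : EuclideanSpace ℝ (Fin d) → T → ℝ)
    (hpmeas : ∀ θ, Measurable (p θ))
    (hppos : ∀ θ ∈ Θ, ∀ τ, 0 < p θ τ)
    (hpdens : ∀ θ ∈ Θ, ∫ τ, p θ τ ∂μ0 = 1)
    (Dp : EuclideanSpace ℝ (Fin d) → T → EuclideanSpace ℝ (Fin d))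
    (hpdiff : ∀ τ, ∀ θ ∈ Θ, HasGradientAt (fun θ' => p θ' τ) (Dp θ τ) θ)
    (hDpcont : ∀ τ, ContinuousOn (fun θ => Dp θ τ) Θ)
    (F : T → ℝ) (hFmeas : Measurable F)
    (Fmax : ℝ) (hFbd : ∀ τ, |F τ| ≤ Fmax)
    (S : ℝ) (hscore : ∀ θ ∈ Θ, ∀ τ, ‖(p θ τ)⁻¹ • Dp θ τ‖ ≤ S)
    (hswap : ∀ θ ∈ Θ, ∀ f : T → ℝ, Measurable f → (∃ B, ∀ τ, |f τ| ≤ B) →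
      HasGradientAt (fun θ' => ∫ τ, f τ * p θ' τ ∂μ0) (∫ τ, f τ • Dp θ τ ∂μ0) θ)
    (l l' : ℝ → ℝ)
    (hlconv : ConvexOn ℝ Set.univ l) (hlmono : StrictMono l)
    (hlderiv : ∀ x, HasDerivAt l (l' x) x) (hl'cont : Continuous l')
    (lam : ℝ)
    (hsolvable : ∀ θ ∈ Θ, ∃ k : ℝ, ∫ τ, l (F τ - k) * p θ τ ∂μ0 = lam) :
    ∀ θ ∈ Θ, HasGradientAt
      (fun θ' => sInf {k : ℝ | ∫ τ, l (F τ - k) * p θ' τ ∂μ0 ≤ lam})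
      ((∫ τ, l' (F τ - sInf {k : ℝ | ∫ τ', l (F τ' - k) * p θ τ' ∂μ0 ≤ lam}) * p θ τ ∂μ0)⁻¹ •
        ∫ τ, l (F τ - sInf {k : ℝ | ∫ τ', l (F τ' - k) * p θ τ' ∂μ0 ≤ lam}) • Dp θ τ ∂μ0)
      θ := by
  have hlc : Continuous l := continuous_iff_continuousAt.2 fun x => (hlderiv x).continuousAt
  have htangent := hlconv.mul_sub_le_sub_of_hasDerivAt hlderiv
  have hl'pos (x : ℝ) : 0 < l' x := by
    linarith [htangent x (x - 1), hlmono (sub_one_lt x)]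
  have hl'mono : Monotone l' := by
    intro x y hxy
    rcases hxy.eq_or_lt with rfl | h
    · exact le_rfl
    · nlinarith [htangent x y, htangent y x]
  have hp0 (θ) (hθ : θ ∈ Θ) (τ : T) : 0 ≤ p θ τ := (hppos θ hθ τ).le
  have hpint (θ) (hθ : θ ∈ Θ) : Integrable (p θ) μ0 :=
    .of_integral_ne_zero (by rw [hpdens θ hθ]; exact one_ne_zero)
  set Φ := fun θ k => ∫ τ, l (F τ - k) * p θ τ ∂μ0
  set M := fun θ k => ∫ τ, l' (F τ - k) * p θ τ ∂μ0
  set SR := fun θ => sInf {k : ℝ | Φ θ k ≤ lam}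
  have hMpos (θ) (hθ : θ ∈ Θ) (k : ℝ) : 0 < M θ k :=
    integral_comp_sub_mul_pos hFmeas hFbd hl'cont hl'mono hl'pos (hpint θ hθ) (hp0 θ hθ)
      (hpdens θ hθ) k
  have hgap (θ) (hθ : θ ∈ Θ) (k₁ k₂ : ℝ) : (k₂ - k₁) * M θ k₂ ≤ Φ θ k₁ - Φ θ k₂ :=
    mul_integral_deriv_le_sub hFmeas hFbd hlconv hlderiv hl'cont (hpint θ hθ) (hp0 θ hθ) k₁ k₂
  have hΦanti (θ) (hθ : θ ∈ Θ) : StrictAnti (Φ θ) := fun k₁ k₂ h =>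
    sub_pos.1 ((mul_pos (sub_pos.2 h) (hMpos θ hθ k₂)).trans_le (hgap θ hθ k₁ k₂))
  have hroot (θ) (hθ : θ ∈ Θ) : Φ θ (SR θ) = lam := by
    obtain ⟨k, hk⟩ := hsolvable θ hθ
    have hSR : SR θ = k := (hΦanti θ hθ).sInf_setOf_le hk
    rw [hSR]
    exact hk
  have hgrad (φ : ℝ → ℝ) (hφ : Continuous φ) (k : ℝ) (θ) (hθ : θ ∈ Θ) :
      HasGradientAt (fun θ' => ∫ τ, φ (F τ - k) * p θ' τ ∂μ0)
        (∫ τ, φ (F τ - k) • Dp θ τ ∂μ0) θ :=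
    hswap θ hθ _ (hφ.measurable.comp (hFmeas.sub_const k)) (exists_abs_comp_sub_le hFbd hφ k)
  intro θ hθ
  have hΘ : ∀ᶠ θ' in 𝓝 θ, θ' ∈ Θ := hΘopen.mem_nhds hθ
  have hΦcont (k : ℝ) : ContinuousAt (fun θ' => Φ θ' k) θ :=
    (hgrad l hlc k θ hθ).hasFDerivAt.continuousAt
  have hMcont (k : ℝ) : ContinuousAt (fun θ' => M θ' k) θ :=
    (hgrad l' hl'cont k θ hθ).hasFDerivAt.continuousAt
  have hSRcont : ContinuousAt SR θ :=
    continuousAt_root_of_strictAnti (hΘ.mono hΦanti) hΦcont (hΘ.mono hroot)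
  have hMSR : Tendsto (fun θ' => M θ' (SR θ')) (𝓝 θ) (𝓝 (M θ (SR θ))) :=
    tendsto_apply_of_antitone
      (hΘ.mono fun θ' hθ' => antitone_integral_comp_sub_mul hFmeas hFbd hl'cont hl'mono
        (hpint θ' hθ') (hp0 θ' hθ'))
      hMcont
      (continuous_integral_comp_sub_mul hFmeas hFbd hl'cont (hpint θ hθ)).continuousAt hSRcont
  have hΦgrad : HasGradientAt (fun θ' => Φ θ' (SR θ) - lam)
      (∫ τ, l (F τ - SR θ) • Dp θ τ ∂μ0) θ :=
    (hgrad l hlc (SR θ) θ hθ).hasFDerivAt.sub_const lam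
  have hdiff : HasGradientAt (fun θ' => SR θ' - SR θ)
      ((M θ (SR θ))⁻¹ • ∫ τ, l (F τ - SR θ) • Dp θ τ ∂μ0) θ := by
    refine hΦgrad.of_mul_le_of_le_mul (sub_self _) ?_ ?_ hMSR (hMcont (SR θ)) (hMpos θ hθ _).ne'
    · filter_upwards [hΘ] with θ' hθ'
      simpa only [hroot θ' hθ'] using hgap θ' hθ' (SR θ) (SR θ')
    · filter_upwards [hΘ] with θ' hθ'
      have h := hgap θ' hθ' (SR θ') (SR θ)
      rw [hroot θ' hθ'] at h
      linarith
  exact (hasFDerivAt_sub_const_iff (SR θ)).1 hdiff.hasFDerivAt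
end

section
/- In the policy-gradient setting, let β > 0, take l(x) = exp(βx) and λ = 1, and define the entropic risk SR(θ) = inf{ k ∈ ℝ : E_θ[exp(β(F − k))] ≤ 1 }. Then θ ↦ SR(θ) is differentiable on Θ and ∇SR(θ) = β^{−1}·E_θ[exp(β(F − SR(θ)))·G(θ)]. -/
open MeasureTheory

/-- The entropic risk of `F` under the density `q` is `β⁻¹ * log E[exp (β F)]`. -/
theorem sInf_integral_exp_le_one_eq {T : Type*} [MeasurableSpace T] {μ : Measure T}
    {q F : T → ℝ} {β : ℝ} (hβ : 0 < β) (hM : 0 < ∫ τ, Real.exp (β * F τ) * q τ ∂μ) :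
    sInf {k : ℝ | ∫ τ, Real.exp (β * (F τ - k)) * q τ ∂μ ≤ 1} =
      β⁻¹ * Real.log (∫ τ, Real.exp (β * F τ) * q τ ∂μ) := by
  have hshift (k : ℝ) : ∫ τ, Real.exp (β * (F τ - k)) * q τ ∂μ =
      Real.exp (-(β * k)) * ∫ τ, Real.exp (β * F τ) * q τ ∂μ := by
    rw [← integral_const_mul]
    congr 1 with τ
    rw [← mul_assoc, ← Real.exp_add]
    ring_nf
  have hset : {k : ℝ | ∫ τ, Real.exp (β * (F τ - k)) * q τ ∂μ ≤ 1} =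
      Set.Ici (β⁻¹ * Real.log (∫ τ, Real.exp (β * F τ) * q τ ∂μ)) := by
    ext k
    rw [Set.mem_ofPred_eq, hshift, Set.mem_Ici, inv_mul_le_iff₀ hβ, Real.log_le_iff_le_exp hM,
      Real.exp_neg, inv_mul_le_iff₀ (Real.exp_pos _), mul_one]
  rw [hset, csInf_Ici]

/-- The exponential moment of a bounded function under a positive density is positive. -/
theorem integral_exp_mul_density_pos {T : Type*} [MeasurableSpace T] {μ : Measure T}
    {q F : T → ℝ} {β C : ℝ} (hβ : 0 < β) (hq : ∀ τ, 0 < q τ) (hq1 : ∫ τ, q τ ∂μ = 1)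
    (hF : Measurable F) (hFC : ∀ τ, |F τ| ≤ C) :
    0 < ∫ τ, Real.exp (β * F τ) * q τ ∂μ := by
  have hqi : Integrable q μ := by
    by_contra h
    simp [integral_undef h] at hq1
  have hi : Integrable (fun τ => Real.exp (β * F τ) * q τ) μ := by
    refine hqi.bdd_mul (c := Real.exp (β * C)) (by fun_prop) (ae_of_all _ fun τ => ?_)
    rw [Real.norm_eq_abs, Real.abs_exp]
    have := (abs_le.1 (hFC τ)).2
    gcongr
  calc 0 < Real.exp (β * -C) * ∫ τ, q τ ∂μ := by rw [hq1]; positivity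
    _ = ∫ τ, Real.exp (β * -C) * q τ ∂μ := (integral_const_mul _ _).symm
    _ ≤ _ := by
      refine integral_mono (hqi.const_mul _) hi fun τ => ?_
      have := (abs_le.1 (hFC τ)).1
      have := (hq τ).le
      dsimp only
      gcongr

/-- Chain rule for the gradient of `c * log f`. -/
theorem HasGradientAt.const_mul_log {E : Type*} [NormedAddCommGroup E] [InnerProductSpace ℝ E]
    [CompleteSpace E] {f : E → ℝ} {f' x : E} (c : ℝ) (hf : HasGradientAt f f' x) (hx : f x ≠ 0) :
    HasGradientAt (fun y => c * Real.log (f y)) (c • (f x)⁻¹ • f') x := by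
  rw [hasGradientAt_iff_hasFDerivAt] at hf ⊢
  simpa using (hf.log hx).const_mul c

/-- policy gradient theorem for the entropic risk.  In the policy-gradient
setting, with `l(x) = exp(βx)` (`β > 0`) and `λ = 1`, the entropic risk
`SR(θ) = inf{k : E_θ[exp(β(F − k))] ≤ 1}` is differentiable on `Θ` with
`∇SR(θ) = β⁻¹·E_θ[exp(β(F − SR(θ)))·G(θ)]`. -/
theorem policy_gradient_entropic_risk
    {d : ℕ} {T : Type*} [MeasurableSpace T] (μ0 : Measure T) [SigmaFinite μ0]
    (Θ : Set (EuclideanSpace ℝ (Fin d))) (hΘopen : IsOpen Θ) (hΘconv : Convex ℝ Θ)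
    (p : EuclideanSpace ℝ (Fin d) → T → ℝ)
    (hpmeas : ∀ θ, Measurable (p θ))
    (hppos : ∀ θ ∈ Θ, ∀ τ, 0 < p θ τ)
    (hpdens : ∀ θ ∈ Θ, ∫ τ, p θ τ ∂μ0 = 1)
    (Dp : EuclideanSpace ℝ (Fin d) → T → EuclideanSpace ℝ (Fin d))
    (hpdiff : ∀ τ, ∀ θ ∈ Θ, HasGradientAt (fun θ' => p θ' τ) (Dp θ τ) θ)
    (hDpcont : ∀ τ, ContinuousOn (fun θ => Dp θ τ) Θ)
    (F : T → ℝ) (hFmeas : Measurable F)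
    (Fmax : ℝ) (hFbd : ∀ τ, |F τ| ≤ Fmax)
    (S : ℝ) (hscore : ∀ θ ∈ Θ, ∀ τ, ‖(p θ τ)⁻¹ • Dp θ τ‖ ≤ S)
    (hswap : ∀ θ ∈ Θ, ∀ f : T → ℝ, Measurable f → (∃ B, ∀ τ, |f τ| ≤ B) →
      HasGradientAt (fun θ' => ∫ τ, f τ * p θ' τ ∂μ0) (∫ τ, f τ • Dp θ τ ∂μ0) θ)
    (β : ℝ) (hβ : 0 < β) :
    ∀ θ ∈ Θ, HasGradientAt
      (fun θ' => sInf {k : ℝ | ∫ τ, Real.exp (β * (F τ - k)) * p θ' τ ∂μ0 ≤ 1})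
      (β⁻¹ •
        ∫ τ, Real.exp (β * (F τ -
          sInf {k : ℝ | ∫ τ', Real.exp (β * (F τ' - k)) * p θ τ' ∂μ0 ≤ 1})) • Dp θ τ ∂μ0)
      θ := by
  intro θ hθ
  have hpos (θ') (h : θ' ∈ Θ) : 0 < ∫ τ, Real.exp (β * F τ) * p θ' τ ∂μ0 :=
    integral_exp_mul_density_pos hβ (hppos θ' h) (hpdens θ' h) hFmeas hFbd
  have hgrad := (hswap θ hθ (fun τ => Real.exp (β * F τ)) (by fun_prop)
    ⟨Real.exp (β * Fmax), fun τ => by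
      rw [Real.abs_exp]
      have := (abs_le.1 (hFbd τ)).2
      gcongr⟩).const_mul_log β⁻¹ (hpos θ hθ).ne'
  rw [sInf_integral_exp_le_one_eq hβ (hpos θ hθ)]
  convert hgrad.congr_of_eventuallyEq ?_ using 2
  · rw [← integral_smul]
    congr 1 with τ
    rw [smul_smul, mul_sub, mul_inv_cancel_left₀ hβ.ne', Real.exp_sub, Real.exp_log (hpos θ hθ),
      div_eq_inv_mul]
  · filter_upwards [hΘopen.mem_nhds hθ] with θ' h
    exact sInf_integral_exp_le_one_eq hβ (hpos θ' h)
end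

section
/- In the policy-gradient setting, let l : ℝ → ℝ be convex, increasing and continuously differentiable with l' convex or Lipschitz, and suppose there exists x ∈ ℝ with l'(x) = 1. For each θ ∈ Θ, assume there exists a (necessarily unique under the stated assumptions) real number SR̄(θ) with E_θ[l'(F − SR̄(θ))] = 1, equal to inf{ k ∈ ℝ : E_θ[l'(F − k)] ≤ 1 }, and define the optimized certainty equivalent OCE(θ) = inf_{k ∈ ℝ} { k + E_θ[l(F − k)] }. Then θ ↦ OCE(θ) is differentiable on Θ and ∇OCE(θ) = E_θ[l(F − SR̄(θ))·G(θ)]. -/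
open MeasureTheory Filter Topology Asymptotics

namespace ConvexOn

variable {l l' : ℝ → ℝ}

lemma add_deriv_mul_sub_le (hl : ConvexOn ℝ Set.univ l) (hd : ∀ x, HasDerivAt l (l' x) x)
    (x y : ℝ) : l y + l' y * (x - y) ≤ l x := by
  rcases lt_trichotomy x y with h | rfl | h
  · have := hl.slope_le_of_hasDerivAt (Set.mem_univ x) (Set.mem_univ y) h (hd y)
    rw [slope_def_field, div_le_iff₀ (by linarith)] at this
    linarith
  · simp
  · have := hl.le_slope_of_hasDerivAt (Set.mem_univ y) (Set.mem_univ x) h (hd y)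
    rw [slope_def_field, le_div_iff₀ (by linarith)] at this
    linarith

lemma monotone_of_hasDerivAt (hl : ConvexOn ℝ Set.univ l) (hd : ∀ x, HasDerivAt l (l' x) x) :
    Monotone l' := by
  intro x y hxy
  rcases hxy.eq_or_lt with rfl | h
  · rfl
  · have h₁ := hl.add_deriv_mul_sub_le hd x y
    have h₂ := hl.add_deriv_mul_sub_le hd y x
    by_contra! hlt
    nlinarith

lemma abs_sub_le_of_hasDerivAt (hl : ConvexOn ℝ Set.univ l) (hmono : Monotone l)
    (hd : ∀ x, HasDerivAt l (l' x) x) {x y b : ℝ} (hx : x ≤ b) (hy : y ≤ b) :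
    |l x - l y| ≤ l' b * |x - y| := by
  wlog hxy : y ≤ x generalizing x y
  · rw [abs_sub_comm, abs_sub_comm x]
    exact this hy hx (le_of_not_ge hxy)
  rw [abs_of_nonneg (sub_nonneg.2 (hmono hxy)), abs_of_nonneg (sub_nonneg.2 hxy)]
  have h₁ := hl.add_deriv_mul_sub_le hd y x
  have h₂ := mul_le_mul_of_nonneg_right (hl.monotone_of_hasDerivAt hd hx) (sub_nonneg.2 hxy)
  linarith

end ConvexOn

lemma Monotone.exists_abs_comp_sub_le {T : Type*} {f : ℝ → ℝ} (hf : Monotone f) {F : T → ℝ}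
    {M : ℝ} (hF : ∀ τ, |F τ| ≤ M) (k : ℝ) : ∃ B, ∀ τ, |f (F τ - k)| ≤ B := by
  refine ⟨max |f (-M - k)| |f (M - k)|, fun τ => ?_⟩
  obtain ⟨h₁, h₂⟩ := abs_le.1 (hF τ)
  exact abs_le_max_abs_abs (hf (by linarith)) (hf (by linarith))

/-- A bound on the score controls the relative change of a positive density. -/
lemma abs_sub_le_mul_exp_sub_one {E : Type*} [NormedAddCommGroup E] [InnerProductSpace ℝ E]
    [CompleteSpace E] {s : Set E} (hs : Convex ℝ s) {q : E → ℝ} {Dq : E → E} {S : ℝ}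
    (hpos : ∀ x ∈ s, 0 < q x) (hd : ∀ x ∈ s, HasGradientAt q (Dq x) x)
    (hS : ∀ x ∈ s, ‖(q x)⁻¹ • Dq x‖ ≤ S) {x y : E} (hx : x ∈ s) (hy : y ∈ s) :
    |q y - q x| ≤ q x * (Real.exp (S * ‖y - x‖) - 1) := by
  have hlog : ‖Real.log (q y) - Real.log (q x)‖ ≤ S * ‖y - x‖ := by
    refine hs.norm_image_sub_le_of_norm_hasFDerivWithin_le
      (fun z hz => ((hd z hz).hasFDerivAt.log (hpos z hz).ne').hasFDerivWithinAt) (fun z hz => ?_)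
      hx hy
    have := hS z hz
    rw [norm_smul] at this ⊢
    simpa using this
  obtain ⟨h₁, h₂⟩ := abs_le.1 hlog
  set a := S * ‖y - x‖
  have hqx := hpos x hx
  have e : q y = q x * Real.exp (Real.log (q y) - Real.log (q x)) := by
    rw [Real.exp_sub, Real.exp_log (hpos y hy), Real.exp_log hqx]
    field_simp
  have u := mul_le_mul_of_nonneg_left (Real.exp_le_exp.2 h₂) hqx.le
  have v := mul_le_mul_of_nonneg_left (Real.exp_le_exp.2 h₁) hqx.le
  have hsum : 2 ≤ Real.exp a + Real.exp (-a) := by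
    have := Real.one_le_cosh a
    rw [Real.cosh_eq] at this
    linarith
  have w := mul_le_mul_of_nonneg_left hsum hqx.le
  rw [abs_le]
  constructor <;> linarith

lemma MeasureTheory.Integrable.comp_sub_mul {T : Type*} [MeasurableSpace T] {μ : Measure T}
    {q : T → ℝ} (hq : Integrable q μ) {f : ℝ → ℝ} (hf : Monotone f) {F : T → ℝ}
    (hFm : Measurable F) {M : ℝ} (hF : ∀ τ, |F τ| ≤ M) (k : ℝ) :
    Integrable (fun τ => f (F τ - k) * q τ) μ := by
  obtain ⟨B, hB⟩ := hf.exists_abs_comp_sub_le hF k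
  exact hq.bdd_mul (hf.measurable.comp (hFm.sub_const k)).aestronglyMeasurable
    (Eventually.of_forall hB)

/-- The infimum defining the optimized certainty equivalent is attained at every solution of the
first-order condition. -/
lemma isLeast_range_add_integral {T : Type*} [MeasurableSpace T] {μ : Measure T}
    {q : T → ℝ} (hq0 : ∀ τ, 0 < q τ) (hq1 : ∫ τ, q τ ∂μ = 1) {F : T → ℝ} (hFm : Measurable F)
    {M : ℝ} (hF : ∀ τ, |F τ| ≤ M) {l l' : ℝ → ℝ} (hl : ConvexOn ℝ Set.univ l)
    (hmono : Monotone l) (hd : ∀ x, HasDerivAt l (l' x) x) {s : ℝ}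
    (hs : ∫ τ, l' (F τ - s) * q τ ∂μ = 1) :
    IsLeast (Set.range fun k : ℝ => k + ∫ τ, l (F τ - k) * q τ ∂μ)
      (s + ∫ τ, l (F τ - s) * q τ ∂μ) := by
  refine ⟨⟨s, rfl⟩, ?_⟩
  rintro _ ⟨k, rfl⟩
  have hq : Integrable q μ := .of_integral_ne_zero (by simp [hq1])
  have i₁ := hq.comp_sub_mul hmono hFm hF
  have i₂ := hq.comp_sub_mul (hl.monotone_of_hasDerivAt hd) hFm hF s
  have key : ∫ τ, (l (F τ - s) * q τ + (s - k) * (l' (F τ - s) * q τ)) ∂μ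
      ≤ ∫ τ, l (F τ - k) * q τ ∂μ := by
    refine integral_mono ((i₁ s).add (i₂.const_mul _)) (i₁ k) fun τ => ?_
    have h := mul_le_mul_of_nonneg_right (hl.add_deriv_mul_sub_le hd (F τ - k) (F τ - s)) (hq0 τ).le
    dsimp only
    linarith
  rw [integral_add (i₁ s) (i₂.const_mul _), integral_const_mul, hs] at key
  dsimp only
  linarith

/-- Unique roots of antitone functions depending continuously on a parameter vary
continuously. -/
lemma tendsto_root_of_antitone {X : Type*} [TopologicalSpace X] {φ : X → ℝ → ℝ} {s : X → ℝ}
    {x : X} {c : ℝ} (hanti : ∀ᶠ y in 𝓝 x, Antitone (φ y)) (hroot : ∀ᶠ y in 𝓝 x, φ y (s y) = c)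
    (huniq : ∀ k, φ x k = c → k = s x) (hcont : ∀ k, ContinuousAt (fun y => φ y k) x) :
    Tendsto s (𝓝 x) (𝓝 (s x)) := by
  have ha := hanti.self_of_nhds
  have hr := hroot.self_of_nhds
  refine tendsto_order.2 ⟨fun k hk => ?_, fun k hk => ?_⟩
  · have hlt : c < φ x k := lt_of_le_of_ne (hr ▸ ha hk.le) fun h => hk.ne (huniq k h.symm)
    filter_upwards [hanti, hroot, (hcont k).eventually (lt_mem_nhds hlt)] with y h₁ h₂ h₃
    by_contra! h
    exact absurd (h₁ h) (by rw [h₂]; exact h₃.not_ge)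
  · have hlt : φ x k < c := lt_of_le_of_ne (hr ▸ ha hk.le) fun h => hk.ne' (huniq k h)
    filter_upwards [hanti, hroot, (hcont k).eventually (gt_mem_nhds hlt)] with y h₁ h₂ h₃
    by_contra! h
    exact absurd (h₁ h) (by rw [h₂]; exact h₃.not_ge)

/-- policy gradient theorem for the optimized certainty equivalent.  In the
policy-gradient setting, with a convex, increasing, continuously differentiable loss `l`
(derivative `l'` convex or Lipschitz, attaining the value 1), if `SRb θ` is the
(unique) real number with `E_θ[l'(F − SRb θ)] = 1`, equal to
`inf{k : E_θ[l'(F − k)] ≤ 1}`, then `OCE(θ) = inf_k {k + E_θ[l(F − k)]}` is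
differentiable on `Θ` with `∇OCE(θ) = E_θ[l(F − SRb θ)·G(θ)]`. -/
theorem policy_gradient_oce
    {d : ℕ} {T : Type*} [MeasurableSpace T] (μ0 : Measure T) [SigmaFinite μ0]
    (Θ : Set (EuclideanSpace ℝ (Fin d))) (hΘopen : IsOpen Θ) (hΘconv : Convex ℝ Θ)
    (p : EuclideanSpace ℝ (Fin d) → T → ℝ)
    (hpmeas : ∀ θ, Measurable (p θ))
    (hppos : ∀ θ ∈ Θ, ∀ τ, 0 < p θ τ)
    (hpdens : ∀ θ ∈ Θ, ∫ τ, p θ τ ∂μ0 = 1)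
    (Dp : EuclideanSpace ℝ (Fin d) → T → EuclideanSpace ℝ (Fin d))
    (hpdiff : ∀ τ, ∀ θ ∈ Θ, HasGradientAt (fun θ' => p θ' τ) (Dp θ τ) θ)
    (hDpcont : ∀ τ, ContinuousOn (fun θ => Dp θ τ) Θ)
    (F : T → ℝ) (hFmeas : Measurable F)
    (Fmax : ℝ) (hFbd : ∀ τ, |F τ| ≤ Fmax)
    (S : ℝ) (hscore : ∀ θ ∈ Θ, ∀ τ, ‖(p θ τ)⁻¹ • Dp θ τ‖ ≤ S)
    (hswap : ∀ θ ∈ Θ, ∀ f : T → ℝ, Measurable f → (∃ B, ∀ τ, |f τ| ≤ B) →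
      HasGradientAt (fun θ' => ∫ τ, f τ * p θ' τ ∂μ0) (∫ τ, f τ • Dp θ τ ∂μ0) θ)
    (l l' : ℝ → ℝ)
    (hlconv : ConvexOn ℝ Set.univ l) (hlmono : Monotone l)
    (hlderiv : ∀ x, HasDerivAt l (l' x) x) (hl'cont : Continuous l')
    (hl'reg : ConvexOn ℝ Set.univ l' ∨ ∃ K : NNReal, LipschitzWith K l')
    (hl'one : ∃ x : ℝ, l' x = 1)
    (SRb : EuclideanSpace ℝ (Fin d) → ℝ)
    (hSRbroot : ∀ θ ∈ Θ, ∫ τ, l' (F τ - SRb θ) * p θ τ ∂μ0 = 1)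
    (hSRbuniq : ∀ θ ∈ Θ, ∀ k : ℝ, (∫ τ, l' (F τ - k) * p θ τ ∂μ0 = 1) → k = SRb θ)
    (hSRbinf : ∀ θ ∈ Θ, SRb θ = sInf {k : ℝ | ∫ τ, l' (F τ - k) * p θ τ ∂μ0 ≤ 1}) :
    ∀ θ ∈ Θ, HasGradientAt
      (fun θ' => ⨅ k : ℝ, (k + ∫ τ, l (F τ - k) * p θ' τ ∂μ0))
      (∫ τ, l (F τ - SRb θ) • Dp θ τ ∂μ0) θ := by
  intro θ hθ
  have hmem : ∀ᶠ θ' in 𝓝 θ, θ' ∈ Θ := hΘopen.mem_nhds hθ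
  have hpint : ∀ θ' ∈ Θ, Integrable (p θ') μ0 := fun θ' h =>
    .of_integral_ne_zero (by simp [hpdens θ' h])
  have hl'mono := hlconv.monotone_of_hasDerivAt hlderiv
  have hgrad : ∀ {f : ℝ → ℝ}, Monotone f → ∀ k, HasGradientAt
      (fun θ' => ∫ τ, f (F τ - k) * p θ' τ ∂μ0) (∫ τ, f (F τ - k) • Dp θ τ ∂μ0) θ :=
    fun hf k => hswap θ hθ _ (hf.measurable.comp (hFmeas.sub_const k))
      (hf.exists_abs_comp_sub_le hFbd k)
  have hs : Tendsto SRb (𝓝 θ) (𝓝 (SRb θ)) := by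
    refine tendsto_root_of_antitone (φ := fun θ' k => ∫ τ, l' (F τ - k) * p θ' τ ∂μ0) (c := 1)
      ?_ (hmem.mono hSRbroot) (hSRbuniq θ hθ) fun k => (hgrad hl'mono k).continuousAt
    filter_upwards [hmem] with θ' h j k hjk
    have hi := (hpint θ' h).comp_sub_mul hl'mono hFmeas hFbd
    exact integral_mono (hi k) (hi j) fun τ =>
      mul_le_mul_of_nonneg_right (hl'mono (by linarith)) (hppos θ' h τ).le
  have hleast : ∀ θ' ∈ Θ, IsLeast (Set.range fun k : ℝ => k + ∫ τ, l (F τ - k) * p θ' τ ∂μ0)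
      (SRb θ' + ∫ τ, l (F τ - SRb θ') * p θ' τ ∂μ0) := fun θ' h =>
    isLeast_range_add_integral (hppos θ' h) (hpdens θ' h) hFmeas hFbd hlconv hlmono hlderiv
      (hSRbroot θ' h)
  set V : EuclideanSpace ℝ (Fin d) → ℝ :=
    fun θ' => ⨅ k : ℝ, (k + ∫ τ, l (F τ - k) * p θ' τ ∂μ0)
  set H : EuclideanSpace ℝ (Fin d) → ℝ := fun θ' => SRb θ + ∫ τ, l (F τ - SRb θ) * p θ' τ ∂μ0
  have hV : ∀ θ' ∈ Θ, V θ' = SRb θ' + ∫ τ, l (F τ - SRb θ') * p θ' τ ∂μ0 := fun θ' h =>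
    (hleast θ' h).csInf_eq
  have hH : HasFDerivAt H _ θ := (hgrad hlmono (SRb θ)).hasFDerivAt.const_add (SRb θ)
  set L := l' (Fmax - SRb θ + 1)
  have hbound : ∀ᶠ θ' in 𝓝 θ,
      ‖V θ' - H θ'‖ ≤ ‖L * (SRb θ' - SRb θ) * (Real.exp (S * ‖θ' - θ‖) - 1)‖ := by
    have hnear : ∀ᶠ θ' in 𝓝 θ, SRb θ - 1 < SRb θ' := hs.eventually (lt_mem_nhds (by linarith))
    filter_upwards [hmem, hnear] with θ' h hn
    have hi := (hpint θ hθ).comp_sub_mul hlmono hFmeas hFbd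
    have hi' := (hpint θ' h).comp_sub_mul hlmono hFmeas hFbd
    have hup : V θ' ≤ H θ' := by
      rw [hV θ' h]
      exact (hleast θ' h).2 ⟨SRb θ, rfl⟩
    have hlow : SRb θ + ∫ τ, l (F τ - SRb θ) * p θ τ ∂μ0
        ≤ SRb θ' + ∫ τ, l (F τ - SRb θ') * p θ τ ∂μ0 := (hleast θ hθ).2 ⟨SRb θ', rfl⟩
    have hdiff : |∫ τ, (l (F τ - SRb θ) - l (F τ - SRb θ')) * (p θ' τ - p θ τ) ∂μ0|
        ≤ L * |SRb θ' - SRb θ| * (Real.exp (S * ‖θ' - θ‖) - 1) := by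
      have hb : ∀ τ, ‖(l (F τ - SRb θ) - l (F τ - SRb θ')) * (p θ' τ - p θ τ)‖
          ≤ L * |SRb θ' - SRb θ| * (Real.exp (S * ‖θ' - θ‖) - 1) * p θ τ := fun τ => by
        have hF := (abs_le.1 (hFbd τ)).2
        have h₁ : |l (F τ - SRb θ) - l (F τ - SRb θ')| ≤ L * |SRb θ' - SRb θ| := by
          have := hlconv.abs_sub_le_of_hasDerivAt hlmono hlderiv
            (x := F τ - SRb θ) (y := F τ - SRb θ') (b := Fmax - SRb θ + 1)
            (by linarith) (by linarith)
          rwa [sub_sub_sub_cancel_left] at this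
        have h₂ := abs_sub_le_mul_exp_sub_one hΘconv (fun z hz => hppos z hz τ) (hpdiff τ)
          (fun z hz => hscore z hz τ) hθ h
        rw [norm_mul]
        calc _ ≤ L * |SRb θ' - SRb θ| * (p θ τ * (Real.exp (S * ‖θ' - θ‖) - 1)) :=
              mul_le_mul h₁ h₂ (abs_nonneg _) ((abs_nonneg _).trans h₁)
          _ = _ := by ring
      refine (norm_integral_le_of_norm_le ((hpint θ hθ).const_mul _)
        (Eventually.of_forall hb)).trans_eq ?_
      rw [integral_const_mul, hpdens θ hθ, mul_one]
    have hexpand : ∫ τ, (l (F τ - SRb θ) - l (F τ - SRb θ')) * (p θ' τ - p θ τ) ∂μ0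
        = ((∫ τ, l (F τ - SRb θ) * p θ' τ ∂μ0) - ∫ τ, l (F τ - SRb θ') * p θ' τ ∂μ0)
          - ((∫ τ, l (F τ - SRb θ) * p θ τ ∂μ0) - ∫ τ, l (F τ - SRb θ') * p θ τ ∂μ0) := by
      rw [← integral_sub (hi' _) (hi' _), ← integral_sub (hi _) (hi _),
        ← integral_sub (by exact (hi' _).sub (hi' _)) (by exact (hi _).sub (hi _))]
      exact integral_congr_ae (Eventually.of_forall fun τ => by ring)
    have hfin : ‖V θ' - H θ'‖ ≤ L * |SRb θ' - SRb θ| * (Real.exp (S * ‖θ' - θ‖) - 1) := by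
      rw [Real.norm_of_nonpos (sub_nonpos.2 hup), hV θ' h]
      have := (le_abs_self _).trans hdiff
      simp only [H]
      linarith
    refine hfin.trans ?_
    rw [norm_mul, norm_mul]
    have hL : 0 ≤ L := (hlderiv _).nonneg_of_monotone hlmono
    rw [Real.norm_of_nonneg hL]
    exact mul_le_mul_of_nonneg_left (le_abs_self _) (mul_nonneg hL (abs_nonneg _))
  have hexp : (fun θ' => Real.exp (S * ‖θ' - θ‖) - 1) =O[𝓝 θ] fun θ' => θ' - θ := by
    have hO : (fun t : ℝ => Real.exp (S * t) - 1) =O[𝓝 0] fun t => t := by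
      have hde : HasDerivAt (fun t : ℝ => Real.exp (S * t)) (Real.exp (S * 0) * (S * 1)) 0 :=
        ((hasDerivAt_id (0 : ℝ)).const_mul S).exp
      simpa using hde.isBigO_sub
    have ht : Tendsto (fun θ' => ‖θ' - θ‖) (𝓝 θ) (𝓝 0) := tendsto_norm_sub_self θ
    exact (hO.comp_tendsto ht).of_norm_right
  have hsmall : (fun θ' => L * (SRb θ' - SRb θ)) =o[𝓝 θ] fun _ => (1 : ℝ) := by
    rw [isLittleO_one_iff]
    simpa using (hs.sub_const (SRb θ)).const_mul L
  have hVH : HasFDerivAt (fun θ' => V θ' - H θ') (0 : EuclideanSpace ℝ (Fin d) →L[ℝ] ℝ) θ := by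
    rw [hasFDerivAt_iff_isLittleO]
    have hθ0 : V θ - H θ = 0 := sub_eq_zero.2 (hV θ hθ)
    simp only [hθ0, zero_apply, sub_zero]
    refine (IsBigO.of_bound' hbound).trans_isLittleO ?_
    simpa only [one_mul, isLittleO_norm_right] using hsmall.mul_isBigO hexp.norm_right
  have := hVH.add hH
  rw [zero_add] at this
  rw [hasGradientAt_iff_hasFDerivAt]
  exact this.congr_of_eventuallyEq (Eventually.of_forall fun θ' => by simp)
end

section
/- Let X be a bounded real random variable and let l : ℝ → ℝ be convex, increasing and continuously differentiable such that there exists x ∈ ℝ with l'(x) = 1. Let SR = inf{ k ∈ ℝ : E[l'(X − k)] ≤ 1 } and assume E[l'(X − SR)] = 1. Then inf_{k ∈ ℝ} { k + E[l(X − k)] } = SR + E[l(X − SR)]. -/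
open MeasureTheory

/-- A convex function lies above its tangent lines. -/
theorem ConvexOn.tangent_le_of_hasDerivAt {f : ℝ → ℝ} (hf : ConvexOn ℝ Set.univ f)
    {x f' : ℝ} (hx : HasDerivAt f f' x) (y : ℝ) : f x + f' * (y - x) ≤ f y := by
  rcases lt_trichotomy x y with h | rfl | h
  · have := hf.le_slope_of_hasDerivAt (Set.mem_univ x) (Set.mem_univ y) h hx
    rw [slope_def_field, le_div_iff₀ (sub_pos.2 h)] at this
    linarith
  · simp
  · have := hf.slope_le_of_hasDerivAt (Set.mem_univ y) (Set.mem_univ x) h hx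
    rw [slope_def_field, div_le_iff₀ (sub_pos.2 h)] at this
    linarith

/-- A continuous function of an almost surely bounded real random variable is integrable. -/
theorem Continuous.integrable_comp_of_ae_abs_le {Ω : Type*} [MeasurableSpace Ω]
    {μ : Measure Ω} [IsFiniteMeasure μ] {f : ℝ → ℝ} (hf : Continuous f) {X : Ω → ℝ}
    (hX : AEMeasurable X μ) {C : ℝ} (hC : ∀ᵐ ω ∂μ, |X ω| ≤ C) :
    Integrable (fun ω => f (X ω)) μ := by
  obtain ⟨M, hM⟩ := (isCompact_Icc (a := -C) (b := C)).exists_bound_of_continuousOn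
    hf.continuousOn
  refine Integrable.of_bound (hf.measurable.comp_aemeasurable hX).aestronglyMeasurable M ?_
  filter_upwards [hC] with ω hω
  exact hM _ (abs_le.1 hω)

/-- OCE–UBSR association.  For a bounded real random variable `X` and a
convex, increasing, continuously differentiable loss `l` (derivative `l'`, attaining the
value 1), if `SR = inf{k : E[l'(X − k)] ≤ 1}` satisfies `E[l'(X − SR)] = 1`, then
`inf_k {k + E[l(X − k)]} = SR + E[l(X − SR)]`. -/
theorem oce_ubsr_association
    {Ω : Type*} [MeasurableSpace Ω] (μ : Measure Ω) [IsProbabilityMeasure μ]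
    (X : Ω → ℝ) (hXmeas : Measurable X)
    (C : ℝ) (hXbd : ∀ᵐ ω ∂μ, |X ω| ≤ C)
    (l l' : ℝ → ℝ)
    (hlconv : ConvexOn ℝ Set.univ l) (hlmono : Monotone l)
    (hlderiv : ∀ x, HasDerivAt l (l' x) x) (hl'cont : Continuous l')
    (hl'one : ∃ x : ℝ, l' x = 1)
    (SR : ℝ)
    (hSRdef : SR = sInf {k : ℝ | ∫ ω, l' (X ω - k) ∂μ ≤ 1})
    (hSRroot : ∫ ω, l' (X ω - SR) ∂μ = 1) :
    (⨅ k : ℝ, (k + ∫ ω, l (X ω - k) ∂μ)) = SR + ∫ ω, l (X ω - SR) ∂μ := by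
  have hl : Continuous l := continuous_iff_continuousAt.2 fun x => (hlderiv x).continuousAt
  have hint (f : ℝ → ℝ) (hf : Continuous f) (k : ℝ) : Integrable (fun ω => f (X ω - k)) μ :=
    (hf.comp (continuous_sub_right k)).integrable_comp_of_ae_abs_le hXmeas.aemeasurable hXbd
  have hmin (k : ℝ) : SR + ∫ ω, l (X ω - SR) ∂μ ≤ k + ∫ ω, l (X ω - k) ∂μ := by
    have hl'int := (hint l' hl'cont SR).mul_const (SR - k)
    have hle : ∫ ω, (l (X ω - SR) + l' (X ω - SR) * (SR - k)) ∂μ ≤ ∫ ω, l (X ω - k) ∂μ := by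
      refine integral_mono ((hint l hl SR).add hl'int) (hint l hl k) fun ω => ?_
      simpa using hlconv.tangent_le_of_hasDerivAt (hlderiv (X ω - SR)) (X ω - k)
    rw [integral_add (hint l hl SR) hl'int, integral_mul_const, hSRroot] at hle
    linarith
  exact le_antisymm (ciInf_le ⟨_, Set.forall_mem_range.2 hmin⟩ SR) (le_ciInf hmin)
end

section
/- Let h : ℝ^d → ℝ be differentiable with L-Lipschitz gradient and bounded below by h* ∈ ℝ. Let η > 0, and on a probability space let θ_1 ∈ ℝ^d be deterministic and let random vectors θ_2, …, θ_{N+1} and Ĝ_1, …, Ĝ_N in ℝ^d satisfy θ_{k+1} = θ_k − η·Ĝ_k almost surely for k = 1, …, N. Suppose there are constants κ > 0, m > 0 and C̃ > 0 such that for every k, E[‖∇h(θ_k) − Ĝ_k‖²] ≤ κ/m and E[‖Ĝ_k‖²] ≤ C̃. Then (1/N)·Σ_{k=1}^N E[‖∇h(θ_k)‖²] ≤ 2·(h(θ_1) − h*)/(η·N) + κ/m + η·L·C̃. -/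
open MeasureTheory

/-- Quadratic upper bound for a function whose gradient is `L`-Lipschitz. -/
theorem le_add_inner_add_sq_of_lipschitz_gradient
    {E : Type*} [NormedAddCommGroup E] [InnerProductSpace ℝ E] [CompleteSpace E]
    {h : E → ℝ} {g : E → E} (hg : ∀ x, HasGradientAt h (g x) x)
    {L : ℝ} (hLip : ∀ x y, ‖g x - g y‖ ≤ L * ‖x - y‖) (x v : E) :
    h (x + v) ≤ h x + inner ℝ (g x) v + L / 2 * ‖v‖ ^ 2 := by
  let φ : ℝ → ℝ := fun t => h (x + t • v) - t * inner ℝ (g x) v - L / 2 * ‖v‖ ^ 2 * t ^ 2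
  have hφ (t : ℝ) : HasDerivAt φ
      (inner ℝ (g (x + t • v)) v - inner ℝ (g x) v - L * ‖v‖ ^ 2 * t) t := by
    have hline : HasDerivAt (fun t : ℝ => x + t • v) v t := by
      simpa using ((hasDerivAt_id t).smul_const v).const_add x
    have hcomp : HasDerivAt (fun t : ℝ => h (x + t • v)) (inner ℝ (g (x + t • v)) v) t := by
      exact (hg (x + t • v)).hasFDerivAt.comp_hasDerivAt t hline
    have hlin := (hasDerivAt_id t).mul_const (inner ℝ (g x) v)
    have hquad := (hasDerivAt_pow 2 t).const_mul (L / 2 * ‖v‖ ^ 2)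
    refine ((hcomp.sub hlin).sub hquad).congr_deriv ?_
    norm_num
    ring
  have hanti : AntitoneOn φ (Set.Icc 0 1) := by
    refine antitoneOn_of_deriv_nonpos (convex_Icc 0 1)
      (fun t _ => (hφ t).continuousAt.continuousWithinAt)
      (fun t _ => (hφ t).differentiableAt.differentiableWithinAt) fun t ht => ?_
    rw [interior_Icc] at ht
    rw [(hφ t).deriv, ← inner_sub_left]
    have hcs := real_inner_le_norm (g (x + t • v) - g x) v
    have hl := hLip (x + t • v) x
    rw [add_sub_cancel_left, norm_smul, Real.norm_of_nonneg ht.1.le] at hl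
    nlinarith [mul_le_mul_of_nonneg_right hl (norm_nonneg v)]
  have h01 := hanti (Set.left_mem_Icc.2 zero_le_one) (Set.right_mem_Icc.2 zero_le_one) zero_le_one
  simp only [φ, one_smul, zero_smul, add_zero] at h01
  linarith

/-- One inexact gradient step controls the squared gradient norm by the decrease of the
objective, the gradient error and the step length. -/
theorem sq_norm_gradient_le_of_inexact_step
    {E : Type*} [NormedAddCommGroup E] [InnerProductSpace ℝ E] [CompleteSpace E]
    {h : E → ℝ} {g : E → E} (hg : ∀ x, HasGradientAt h (g x) x)
    {L : ℝ} (hLip : ∀ x y, ‖g x - g y‖ ≤ L * ‖x - y‖) {η : ℝ} (hη : 0 < η) (x v : E) :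
    ‖g x‖ ^ 2 ≤ 2 / η * (h x - h (x - η • v)) + (‖g x - v‖ ^ 2 + η * L * ‖v‖ ^ 2) := by
  have hdesc := le_add_inner_add_sq_of_lipschitz_gradient hg hLip x (-(η • v))
  rw [← sub_eq_add_neg, inner_neg_right, real_inner_smul_right, norm_neg, norm_smul,
    Real.norm_of_nonneg hη.le] at hdesc
  have hpolar := norm_sub_sq_real (g x) v
  have hscaled := mul_le_mul_of_nonneg_left hdesc (by positivity : 0 ≤ 2 / η)
  have hexp : 2 / η * (h x + -(η * inner ℝ (g x) v) + L / 2 * (η * ‖v‖) ^ 2) =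
      2 / η * h x - 2 * inner ℝ (g x) v + η * L * ‖v‖ ^ 2 := by
    field_simp
    ring
  rw [hexp] at hscaled
  nlinarith [sq_nonneg ‖v‖]

/-- non-asymptotic bound for the stochastic gradient iteration
`θ_{k+1} = θ_k − η·Ĝ_k` on an `L`-smooth objective `h` bounded below by `h*`, under the
gradient-estimation-error bound `E[‖∇h(θ_k) − Ĝ_k‖²] ≤ κ/m` and the second-moment bound
`E[‖Ĝ_k‖²] ≤ C̃`:
`(1/N)·Σ_{k=1}^N E[‖∇h(θ_k)‖²] ≤ 2(h(θ_1) − h*)/(ηN) + κ/m + ηLC̃`. -/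
theorem rapg_nonasymptotic_bound
    {d : ℕ} (h : EuclideanSpace ℝ (Fin d) → ℝ)
    (Gh : EuclideanSpace ℝ (Fin d) → EuclideanSpace ℝ (Fin d))
    (hdiff : ∀ x, HasGradientAt h (Gh x) x)
    (L : ℝ) (hL : 0 < L) (hLip : ∀ x y, ‖Gh x - Gh y‖ ≤ L * ‖x - y‖)
    (hstar : ℝ) (hbelow : ∀ x, hstar ≤ h x)
    {Ω : Type*} [MeasurableSpace Ω] (μ : Measure Ω) [IsProbabilityMeasure μ]
    (η : ℝ) (hη : 0 < η) (N : ℕ) (hN : 1 ≤ N)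
    (θ : ℕ → Ω → EuclideanSpace ℝ (Fin d))
    (Ghat : ℕ → Ω → EuclideanSpace ℝ (Fin d))
    (θ1 : EuclideanSpace ℝ (Fin d)) (hθ1 : θ 0 = fun _ => θ1)
    (hmeas : ∀ k, AEStronglyMeasurable (Ghat k) μ)
    (hupd : ∀ k < N, ∀ᵐ ω ∂μ, θ (k + 1) ω = θ k ω - η • Ghat k ω)
    (κ m Ctil : ℝ) (hκ : 0 < κ) (hm : 0 < m) (hCtil : 0 < Ctil)
    (hvar : ∀ k < N,
      ∫⁻ ω, ENNReal.ofReal (‖Gh (θ k ω) - Ghat k ω‖ ^ 2) ∂μ ≤ ENNReal.ofReal (κ / m))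
    (hsec : ∀ k < N,
      ∫⁻ ω, ENNReal.ofReal (‖Ghat k ω‖ ^ 2) ∂μ ≤ ENNReal.ofReal Ctil) :
    (N : ENNReal)⁻¹ * ∑ k ∈ Finset.range N, ∫⁻ ω, ENNReal.ofReal (‖Gh (θ k ω)‖ ^ 2) ∂μ
      ≤ ENNReal.ofReal (2 * (h θ1 - hstar) / (η * N) + κ / m + η * L * Ctil) := by
  have hcont : Continuous Gh :=
    (LipschitzWith.of_dist_le_mul (K := ⟨L, hL.le⟩) fun x y => by
      rw [dist_eq_norm, dist_eq_norm]
      exact hLip x y).continuous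
  have hθmeas (k : ℕ) (hk : k ≤ N) : AEStronglyMeasurable (θ k) μ := by
    induction k with
    | zero => rw [hθ1]; exact aestronglyMeasurable_const
    | succ k ih =>
      exact ((ih (by omega)).sub ((hmeas k).const_smul η)).congr
        ((hupd k hk).mono fun ω hω => hω.symm)
  have hGmeas (k : ℕ) (hk : k < N) : AEStronglyMeasurable (fun ω => Gh (θ k ω)) μ :=
    hcont.comp_aestronglyMeasurable (hθmeas k hk.le)
  have hsq {f : Ω → EuclideanSpace ℝ (Fin d)} (hf : AEStronglyMeasurable f μ) :
      AEMeasurable (fun ω => ENNReal.ofReal (‖f ω‖ ^ 2)) μ :=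
    (hf.norm.aemeasurable.pow_const 2).ennreal_ofReal
  have herr (k : ℕ) (hk : k < N) :
      AEMeasurable (fun ω => ENNReal.ofReal (‖Gh (θ k ω) - Ghat k ω‖ ^ 2)) μ :=
    hsq ((hGmeas k hk).sub (hmeas k))
  have hgap : 0 ≤ 2 / η * (h θ1 - hstar) :=
    mul_nonneg (by positivity) (sub_nonneg.2 (hbelow θ1))
  have hupd' : ∀ᵐ ω ∂μ, ∀ k < N, θ (k + 1) ω = θ k ω - η • Ghat k ω := by
    rw [ae_all_iff]
    intro k
    by_cases hk : k < N
    · filter_upwards [hupd k hk] with ω hω _ using hω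
    · exact .of_forall fun _ hk' => absurd hk' hk
  have hpath : ∀ᵐ ω ∂μ, ∑ k ∈ Finset.range N, ENNReal.ofReal (‖Gh (θ k ω)‖ ^ 2) ≤
      ENNReal.ofReal (2 / η * (h θ1 - hstar)) +
        ∑ k ∈ Finset.range N, (ENNReal.ofReal (‖Gh (θ k ω) - Ghat k ω‖ ^ 2) +
          ENNReal.ofReal (η * L) * ENNReal.ofReal (‖Ghat k ω‖ ^ 2)) := by
    filter_upwards [hupd'] with ω hω
    have hterm (k : ℕ) : ENNReal.ofReal (‖Gh (θ k ω) - Ghat k ω‖ ^ 2) +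
        ENNReal.ofReal (η * L) * ENNReal.ofReal (‖Ghat k ω‖ ^ 2) =
        ENNReal.ofReal (‖Gh (θ k ω) - Ghat k ω‖ ^ 2 + η * L * ‖Ghat k ω‖ ^ 2) := by
      rw [← ENNReal.ofReal_mul (by positivity), ← ENNReal.ofReal_add (by positivity) (by positivity)]
    simp only [hterm]
    rw [← ENNReal.ofReal_sum_of_nonneg fun _ _ => by positivity,
      ← ENNReal.ofReal_sum_of_nonneg fun _ _ => by positivity,
      ← ENNReal.ofReal_add hgap (Finset.sum_nonneg fun _ _ => by positivity)]
    apply ENNReal.ofReal_le_ofReal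
    calc ∑ k ∈ Finset.range N, ‖Gh (θ k ω)‖ ^ 2
        ≤ ∑ k ∈ Finset.range N, (2 / η * (h (θ k ω) - h (θ (k + 1) ω)) +
            (‖Gh (θ k ω) - Ghat k ω‖ ^ 2 + η * L * ‖Ghat k ω‖ ^ 2)) := by
          refine Finset.sum_le_sum fun k hk => ?_
          rw [hω k (Finset.mem_range.1 hk)]
          exact sq_norm_gradient_le_of_inexact_step hdiff hLip hη _ _
      _ ≤ _ := by
          rw [Finset.sum_add_distrib, ← Finset.mul_sum,
            Finset.sum_range_sub' (fun k => h (θ k ω)), hθ1]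
          gcongr
          exact hbelow _
  have htotal : ∑ k ∈ Finset.range N, ∫⁻ ω, ENNReal.ofReal (‖Gh (θ k ω)‖ ^ 2) ∂μ ≤
      ENNReal.ofReal (2 / η * (h θ1 - hstar)) +
        ∑ _k ∈ Finset.range N, (ENNReal.ofReal (κ / m) +
          ENNReal.ofReal (η * L) * ENNReal.ofReal Ctil) := by
    rw [← lintegral_finsetSum' _ fun k hk => hsq (hGmeas k (Finset.mem_range.1 hk))]
    refine (lintegral_mono_ae hpath).trans ?_
    rw [lintegral_add_left measurable_const, lintegral_const, measure_univ, mul_one,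
      lintegral_finsetSum']
    swap
    · exact fun k hk => (herr k (Finset.mem_range.1 hk)).add ((hsq (hmeas k)).const_mul _)
    gcongr with k hk
    rw [lintegral_add_left' (herr k (Finset.mem_range.1 hk)),
      lintegral_const_mul'' _ (hsq (hmeas k))]
    gcongr
    · exact hvar k (Finset.mem_range.1 hk)
    · exact hsec k (Finset.mem_range.1 hk)
  have hNpos : (0 : ℝ) < N := by exact_mod_cast hN
  rw [ENNReal.inv_mul_le_iff (by exact_mod_cast hNpos.ne') (ENNReal.natCast_ne_top N)]
  refine htotal.trans_eq ?_
  rw [Finset.sum_const, Finset.card_range, nsmul_eq_mul, ← ENNReal.ofReal_natCast,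
    ← ENNReal.ofReal_mul (by positivity), ← ENNReal.ofReal_add (by positivity) (by positivity),
    ← ENNReal.ofReal_mul hNpos.le, ← ENNReal.ofReal_add hgap (by positivity),
    ← ENNReal.ofReal_mul hNpos.le]
  congr 1
  field_simp
  ring
end
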